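/- arXiv:1705.10081 — 8 statements merged into one kernel-verified Lean document; each statement's English description precedes it below -/
import Mathlib

section
/- For every k ≥ 2, the Boolean quadratic polytope conv(BQP(k)) is affinely isomorphic to a face of conv(φ_{2k}). Concretely, the face F of conv(φ_{2k}) cut out by the supporting hyperplanes z_{2i-1,2i,2i-1,2i} = 1 for all i ∈ [k] (i.e., the convex hull of the edge-permutation matrices z^σ of those permutations σ of [2k] that map each pair {2i-1,2i} to itself) is affinely isomorphic to conv(BQP(k)), via the relations z_{2i,2j,2i,2j} = x_{ij}, z_{2i,2j,2i,2j-1} = x_{ii} − x_{ij}, z_{2i,2j,2i-1,2j} = x_{jj} − x_{ij} for i < j in [k]. -/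
/-- Ambient space for edge-permutation matrices: rows and columns indexed by
finite subsets of vertices (only 2-element subsets, i.e. edges of `K_n`, carry
nonzero entries). -/
abbrev EdgeSpace (n : ℕ) := Finset (Fin n) → Finset (Fin n) → ℝ

/-- The edge-permutation matrix `z^σ` of a permutation `σ`:
`z^σ_{e,f} = 1` iff `e` is an edge and `σ(e) = f` (zero outside edge pairs). -/
def zMat {n : ℕ} (σ : Equiv.Perm (Fin n)) : EdgeSpace n :=
  fun e f => if e.card = 2 ∧ e.image σ = f then 1 else 0

/-- `φ_n`, the set of edge-permutation matrices of all permutations of `[n]`. -/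
def phi (n : ℕ) : Set (EdgeSpace n) := {z | ∃ σ : Equiv.Perm (Fin n), z = zMat σ}

/-- `F` is a face of `S`: either `S` itself, or the set of maximizers over `S`
of some linear functional. -/
def IsFaceOf {E : Type*} [AddCommGroup E] [Module ℝ E] (F S : Set E) : Prop :=
  F = S ∨ ∃ φ : E →ₗ[ℝ] ℝ, F = {x ∈ S | ∀ y ∈ S, φ y ≤ φ x}

/-- The Boolean quadratic polytope vertex set: tensors `v ⊗ v` for 0/1 vectors `v`. -/
def BQP (α : Type*) [Fintype α] : Set (α → α → ℝ) :=
  {x | ∃ v : α → ℝ, (∀ i, v i = 0 ∨ v i = 1) ∧ x = fun i j => v i * v j}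

/-- Vertex `2i-1` (1-based), i.e. `2i` (0-based), of the pair structure on `[2k]`. -/
def od {k : ℕ} (i : Fin k) : Fin (2 * k) := ⟨2 * i.val, by have := i.isLt; omega⟩

/-- Vertex `2i` (1-based), i.e. `2i+1` (0-based), of the pair structure on `[2k]`. -/
def ev {k : ℕ} (i : Fin k) : Fin (2 * k) := ⟨2 * i.val + 1, by have := i.isLt; omega⟩

lemma Set.EqOn.affineMap_convexHull {E G : Type*} [AddCommGroup E] [Module ℝ E]
    [AddCommGroup G] [Module ℝ G] {f g : E →ᵃ[ℝ] G} {s : Set E} (h : Set.EqOn f g s) :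
    Set.EqOn f g (convexHull ℝ s) := by
  have hc : Convex ℝ {x | f x = g x} := by
    intro x hx y hy a b _ _ hab
    simp only [Set.mem_ofPred_eq] at hx hy ⊢
    rw [Convex.combo_affine_apply hab, Convex.combo_affine_apply hab, hx, hy]
  exact convexHull_min h hc

/-- If a linear functional is at most `c` on `s`, then a point of `convexHull ℝ s` where it
equals `c` is a convex combination of points of `s` where it equals `c`. -/
lemma mem_convexHull_sep_of_eq {E : Type*} [AddCommGroup E] [Module ℝ E] {s : Set E}
    (φ : E →ₗ[ℝ] ℝ) {c : ℝ} (hs : ∀ y ∈ s, φ y ≤ c) {x : E} (hx : x ∈ convexHull ℝ s)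
    (hxc : φ x = c) : x ∈ convexHull ℝ {y ∈ s | φ y = c} := by
  set T := convexHull ℝ {y ∈ s | φ y = c}
  have hc : Convex ℝ {y | φ y < c ∨ φ y = c ∧ y ∈ T} := by
    intro y hy z hz a b ha hb hab
    have hle : ∀ w, (φ w < c ∨ φ w = c ∧ w ∈ T) → φ w ≤ c := fun w hw =>
      hw.elim le_of_lt fun h => h.1.le
    rcases ha.eq_or_lt with rfl | ha'
    · obtain rfl : b = 1 := by linarith
      simpa using hz
    rcases hb.eq_or_lt with rfl | hb'
    · obtain rfl : a = 1 := by linarith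
      simpa using hy
    have hy' := hle y hy
    have hz' := hle z hz
    simp only [Set.mem_ofPred_eq, map_add, map_smul, smul_eq_mul] at hy hz ⊢
    obtain rfl : b = 1 - a := by linarith
    rcases hy with hy | ⟨hy, hyT⟩
    · left; nlinarith
    rcases hz with hz | ⟨hz, hzT⟩
    · left; nlinarith
    · right
      exact ⟨by rw [hy, hz]; ring, convex_convexHull ℝ _ hyT hzT ha hb hab⟩
  have hsub : s ⊆ {y | φ y < c ∨ φ y = c ∧ y ∈ T} := fun y hy =>
    (hs y hy).lt_or_eq.imp_right fun h => ⟨h, subset_convexHull ℝ _ ⟨hy, h⟩⟩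
  rcases convexHull_min hsub hc hx with h | h
  · exact absurd hxc h.ne
  · exact h.2

section Pairs

variable {k : ℕ}

@[simp] lemma ev_inj {i j : Fin k} : ev i = ev j ↔ i = j := by
  simp [ev, Fin.ext_iff]

@[simp] lemma od_inj {i j : Fin k} : od i = od j ↔ i = j := by
  simp [od, Fin.ext_iff]

@[simp] lemma ev_ne_od (i j : Fin k) : ev i ≠ od j := by
  simp only [ev, od, ne_eq, Fin.mk.injEq]; omega

@[simp] lemma od_ne_ev (i j : Fin k) : od i ≠ ev j := (ev_ne_od j i).symm

lemma exists_eq_ev_or_eq_od (a : Fin (2 * k)) : ∃ i : Fin k, a = ev i ∨ a = od i := by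
  refine ⟨⟨a / 2, by omega⟩, ?_⟩
  simp only [ev, od, Fin.ext_iff]; omega

/-- `v` is the 0/1 vector recording which pairs `{od i, ev i}` are fixed pointwise
(`v i = 1`) and which are swapped (`v i = 0`) by `σ`. -/
def Encodes (σ : Equiv.Perm (Fin (2 * k))) (v : Fin k → ℝ) : Prop :=
  ∀ i, v i = 1 ∧ σ (ev i) = ev i ∧ σ (od i) = od i ∨
    v i = 0 ∧ σ (ev i) = od i ∧ σ (od i) = ev i

lemma Encodes.zero_or_one {σ : Equiv.Perm (Fin (2 * k))} {v : Fin k → ℝ} (h : Encodes σ v)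
    (i : Fin k) : v i = 0 ∨ v i = 1 :=
  (h i).elim (fun h => .inr h.1) fun h => .inl h.1

lemma exists_encodes_iff (σ : Equiv.Perm (Fin (2 * k))) :
    (∃ v, Encodes σ v) ↔ ∀ i : Fin k, Finset.image σ {od i, ev i} = {od i, ev i} := by
  constructor
  · rintro ⟨v, h⟩ i
    rw [Finset.image_insert, Finset.image_singleton]
    rcases h i with ⟨-, h1, h2⟩ | ⟨-, h1, h2⟩ <;> rw [h1, h2]
    exact Finset.pair_comm _ _
  · intro h
    refine ⟨fun i => if σ (ev i) = ev i then 1 else 0, fun i => ?_⟩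
    have h1 : σ (ev i) ∈ ({od i, ev i} : Finset _) := by
      rw [← h i]; exact Finset.mem_image_of_mem _ (by simp)
    have h2 : σ (od i) ∈ ({od i, ev i} : Finset _) := by
      rw [← h i]; exact Finset.mem_image_of_mem _ (by simp)
    have h3 : σ (ev i) ≠ σ (od i) := fun h => ev_ne_od i i (σ.injective h)
    simp only [Finset.mem_insert, Finset.mem_singleton] at h1 h2
    rcases h1 with h1 | h1 <;> rcases h2 with h2 | h2 <;> simp_all

lemma exists_perm_encodes {v : Fin k → ℝ} (hv : ∀ i, v i = 0 ∨ v i = 1) :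
    ∃ σ : Equiv.Perm (Fin (2 * k)), Encodes σ v := by
  classical
  let p : Fin (2 * k) → Fin k := fun a => ⟨a / 2, by omega⟩
  have pe : ∀ i, p (ev i) = i := fun i => by simp only [p, ev, Fin.ext_iff]; omega
  have po : ∀ i, p (od i) = i := fun i => by simp only [p, od, Fin.ext_iff]; omega
  let g : Fin (2 * k) → Fin (2 * k) := fun a =>
    if v (p a) = 1 then a else if a = ev (p a) then od (p a) else ev (p a)
  have hg : Function.Involutive g := by
    intro a
    obtain ⟨i, rfl | rfl⟩ := exists_eq_ev_or_eq_od a <;> by_cases h : v i = 1 <;>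
      simp [g, pe, po, h]
  refine ⟨hg.toPerm, fun i => ?_⟩
  rcases hv i with h | h <;> simp [g, pe, po, h]

/-- The matrix `v ⊗ v`. -/
def tensorSq (v : Fin k → ℝ) : Fin k → Fin k → ℝ := fun i j => v i * v j

lemma Encodes.exists_affine_apply_eq (a c : Fin (2 * k)) :
    ∃ (i : Fin k) (α β : ℝ), ∀ (σ : Equiv.Perm (Fin (2 * k))) (v : Fin k → ℝ), Encodes σ v →
      (if σ a = c then 1 else 0) = α + β * v i := by
  obtain ⟨i, rfl | rfl⟩ := exists_eq_ev_or_eq_od a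
  · refine ⟨i, if od i = c then 1 else 0,
      (if ev i = c then 1 else 0) - (if od i = c then 1 else 0), fun σ v h => ?_⟩
    rcases h i with ⟨h0, h1, -⟩ | ⟨h0, h1, -⟩ <;> rw [h0, h1] <;> ring
  · refine ⟨i, if ev i = c then 1 else 0,
      (if od i = c then 1 else 0) - (if ev i = c then 1 else 0), fun σ v h => ?_⟩
    rcases h i with ⟨h0, -, h1⟩ | ⟨h0, -, h1⟩ <;> rw [h0, h1] <;> ring

/-- The entry of `x` at `(i, j)` as a linear functional. -/
def entryLin {ι κ : Type*} (i : ι) (j : κ) : (ι → κ → ℝ) →ₗ[ℝ] ℝ where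
  toFun x := x i j
  map_add' _ _ := rfl
  map_smul' _ _ := rfl

@[simp] lemma entryLin_apply {ι κ : Type*} (i : ι) (j : κ) (x : ι → κ → ℝ) :
    entryLin i j x = x i j := rfl

lemma Encodes.exists_affine_mul (a b c d : Fin (2 * k)) :
    ∃ L : (Fin k → Fin k → ℝ) →ᵃ[ℝ] ℝ, ∀ (σ : Equiv.Perm (Fin (2 * k))) (v : Fin k → ℝ),
      Encodes σ v →
        L (tensorSq v) = (if σ a = c then 1 else 0) * (if σ b = d then 1 else 0) := by
  obtain ⟨i, α, β, h1⟩ := Encodes.exists_affine_apply_eq a c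
  obtain ⟨j, γ, δ, h2⟩ := Encodes.exists_affine_apply_eq b d
  refine ⟨AffineMap.const ℝ _ (α * γ) + (α * δ) • (entryLin j j).toAffineMap +
    (β * γ) • (entryLin i i).toAffineMap + (β * δ) • (entryLin i j).toAffineMap, fun σ v h => ?_⟩
  rw [h1 σ v h, h2 σ v h]
  have sq : ∀ l, v l * v l = v l := fun l => by
    rcases h.zero_or_one l with h | h <;> simp [h]
  simp only [tensorSq, AffineMap.coe_add, AffineMap.coe_smul, Pi.add_apply,
    Pi.smul_apply, AffineMap.const_apply, LinearMap.coe_toAffineMap, entryLin_apply,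
    smul_eq_mul, sq]
  ring

lemma Encodes.exists_affine_zMat_apply (e f : Finset (Fin (2 * k))) :
    ∃ L : (Fin k → Fin k → ℝ) →ᵃ[ℝ] ℝ, ∀ (σ : Equiv.Perm (Fin (2 * k))) (v : Fin k → ℝ),
      Encodes σ v → L (tensorSq v) = zMat σ e f := by
  by_cases he : e.card = 2
  · obtain ⟨a, b, -, rfl⟩ := Finset.card_eq_two.1 he
    choose L hL using fun p : Fin (2 * k) × Fin (2 * k) => Encodes.exists_affine_mul a b p.1 p.2
    refine ⟨∑ p with ({p.1, p.2} : Finset _) = f, L p, fun σ v h => ?_⟩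
    have hsum : (∑ p with ({p.1, p.2} : Finset _) = f, L p) (tensorSq v) =
        ∑ p with ({p.1, p.2} : Finset _) = f, L p (tensorSq v) := by
      induction (Finset.univ.filter fun p : Fin (2 * k) × Fin (2 * k) =>
        ({p.1, p.2} : Finset _) = f) using Finset.induction_on with
      | empty => simp
      | insert p s hp ih => simp [Finset.sum_insert hp, ih]
    rw [hsum, Finset.sum_congr rfl fun p _ => hL p σ v h, Finset.sum_filter,
      Finset.sum_eq_single (σ a, σ b)]
    · simp [zMat, he, Finset.image_insert]
    · rintro ⟨c, d⟩ - hne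
      have : ¬ (σ a = c ∧ σ b = d) := fun h => hne (by rw [h.1, h.2])
      rw [not_and_or] at this
      rcases this with h | h <;> simp [h]
    · simp
  · exact ⟨0, fun σ v _ => by simp [zMat, he]⟩

/-- The affine map inverting the projection of the face onto the Boolean quadratic polytope. -/
lemma Encodes.exists_affine_zMat : ∃ B : (Fin k → Fin k → ℝ) →ᵃ[ℝ] EdgeSpace (2 * k),
    ∀ (σ : Equiv.Perm (Fin (2 * k))) (v : Fin k → ℝ), Encodes σ v →
      B (tensorSq v) = zMat σ := by
  choose L hL using Encodes.exists_affine_zMat_apply (k := k)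
  exact ⟨AffineMap.pi fun e => AffineMap.pi fun f => L e f, fun σ v h => by
    ext e f; exact hL e f σ v h⟩

lemma Encodes.zMat_pair {σ : Equiv.Perm (Fin (2 * k))} {v : Fin k → ℝ} (h : Encodes σ v)
    {i j : Fin k} (hij : i ≠ j) :
    zMat σ {ev i, ev j} {ev i, ev j} = v i * v j ∧
    zMat σ {ev i, ev j} {ev i, od j} = v i * (1 - v j) ∧
    zMat σ {ev i, ev j} {od i, ev j} = v j * (1 - v i) := by
  have hc : ({ev i, ev j} : Finset (Fin (2 * k))).card = 2 :=
    Finset.card_pair (by simpa using hij)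
  have key : ∀ a b c d : Fin (2 * k), a ≠ d →
      (({a, b} : Finset _) = {c, d} ↔ a = c ∧ b = d) := by
    intro a b c d had
    refine ⟨fun h => ?_, fun h => by rw [h.1, h.2]⟩
    have h1 : a ∈ ({c, d} : Finset _) := h ▸ by simp
    have h2 : d ∈ ({a, b} : Finset _) := h ▸ by simp
    simp only [Finset.mem_insert, Finset.mem_singleton] at h1 h2
    exact ⟨h1.resolve_right had, (h2.resolve_left had.symm).symm⟩
  simp only [zMat, hc, true_and, Finset.image_insert, Finset.image_singleton]
  rcases h i with ⟨h0, h1, -⟩ | ⟨h0, h1, -⟩ <;> rcases h j with ⟨h2, h3, -⟩ | ⟨h2, h3, -⟩ <;>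
    rw [h0, h1, h2, h3] <;> simp [key, hij]

/-- The projection onto the Boolean quadratic polytope; `p i` is an index other than `i` used
to read off the diagonal entry at `i`. -/
def bqpProj (p : Fin k → Fin k) : EdgeSpace (2 * k) →ₗ[ℝ] (Fin k → Fin k → ℝ) where
  toFun z i j :=
    if i = j then z {ev i, ev (p i)} {ev i, ev (p i)} + z {ev i, ev (p i)} {ev i, od (p i)}
    else z {ev i, ev j} {ev i, ev j}
  map_add' x y := by
    ext i j
    simp only [Pi.add_apply]
    split_ifs <;> ring
  map_smul' c x := by
    ext i j
    simp only [Pi.smul_apply, smul_eq_mul, RingHom.id_apply]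
    split_ifs <;> ring

lemma Encodes.bqpProj_zMat {σ : Equiv.Perm (Fin (2 * k))} {v : Fin k → ℝ} (h : Encodes σ v)
    {p : Fin k → Fin k} (hp : ∀ i, p i ≠ i) : bqpProj p (zMat σ) = tensorSq v := by
  ext i j
  simp only [bqpProj, LinearMap.coe_mk, AddHom.coe_mk, tensorSq]
  split_ifs with hij
  · subst hij
    rw [(h.zMat_pair (hp i).symm).1, (h.zMat_pair (hp i).symm).2.1]
    rcases h.zero_or_one i with h | h <;> simp [h]
  · exact (h.zMat_pair hij).1

lemma zMat_le_one {n : ℕ} (σ : Equiv.Perm (Fin n)) (e f : Finset (Fin n)) :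
    zMat σ e f ≤ 1 := by
  unfold zMat; split_ifs <;> norm_num

lemma le_one_of_mem_convexHull_phi {n : ℕ} {z : EdgeSpace n} (hz : z ∈ convexHull ℝ (phi n))
    (e f : Finset (Fin n)) : z e f ≤ 1 := by
  have hc : Convex ℝ {z : EdgeSpace n | entryLin e f z ≤ 1} :=
    convex_halfSpace_le (entryLin e f).isLinear 1
  exact convexHull_min (by rintro _ ⟨σ, rfl⟩; exact zMat_le_one σ e f) hc hz

/-- The sum of the entries at the pairs `{od i, ev i}`. -/
def pairSum (k : ℕ) : EdgeSpace (2 * k) →ₗ[ℝ] ℝ :=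
  ∑ i : Fin k, entryLin {od i, ev i} {od i, ev i}

lemma pairSum_apply (z : EdgeSpace (2 * k)) :
    pairSum k z = ∑ i : Fin k, z {od i, ev i} {od i, ev i} := by
  simp [pairSum]

lemma pairSum_le {z : EdgeSpace (2 * k)} (hz : z ∈ convexHull ℝ (phi (2 * k))) :
    pairSum k z ≤ k := by
  rw [pairSum_apply]
  simpa using Finset.sum_le_sum fun (i : Fin k) (_ : i ∈ Finset.univ) =>
    le_one_of_mem_convexHull_phi hz {od i, ev i} {od i, ev i}

lemma pairSum_eq_iff {z : EdgeSpace (2 * k)} (hz : z ∈ convexHull ℝ (phi (2 * k))) :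
    pairSum k z = k ↔ ∀ i : Fin k, z {od i, ev i} {od i, ev i} = 1 := by
  have h := Finset.sum_eq_sum_iff_of_le fun (i : Fin k) (_ : i ∈ Finset.univ) =>
    le_one_of_mem_convexHull_phi hz {od i, ev i} {od i, ev i}
  rw [pairSum_apply]
  simpa using h

lemma zMat_pair_eq_one_iff (σ : Equiv.Perm (Fin (2 * k))) (i : Fin k) :
    zMat σ {od i, ev i} {od i, ev i} = 1 ↔ Finset.image σ {od i, ev i} = {od i, ev i} := by
  have hc : ({od i, ev i} : Finset (Fin (2 * k))).card = 2 := Finset.card_pair (by simp)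
  simp [zMat, hc]

lemma pairSum_zMat_one : pairSum k (zMat 1) = k :=
  (pairSum_eq_iff (subset_convexHull ℝ _ ⟨1, rfl⟩)).2 fun i =>
    (zMat_pair_eq_one_iff 1 i).2 (by simp)

end Pairs

/-- `conv BQP(k)` is affinely isomorphic to the face `F` of `conv φ_{2k}` cut out by
the supporting hyperplanes `z_{2i-1,2i,2i-1,2i} = 1`, `i ∈ [k]` (i.e. the convex
hull of the `z^σ` for permutations mapping each pair `{2i-1,2i}` to itself), via
`z_{2i,2j,2i,2j} = x_{ij}`, `z_{2i,2j,2i,2j-1} = x_{ii} - x_{ij}`,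
`z_{2i,2j,2i-1,2j} = x_{jj} - x_{ij}` for `i < j`. -/
theorem bqp_face_of_phi (k : ℕ) (hk : 2 ≤ k) :
    let F : Set (EdgeSpace (2 * k)) :=
      {z ∈ convexHull ℝ (phi (2 * k)) |
        ∀ i : Fin k, z {od i, ev i} {od i, ev i} = 1}
    IsFaceOf F (convexHull ℝ (phi (2 * k))) ∧
    F = convexHull ℝ
      {z | ∃ σ : Equiv.Perm (Fin (2 * k)),
        (∀ i : Fin k, Finset.image σ {od i, ev i} = {od i, ev i}) ∧ z = zMat σ} ∧
    ∃ A : EdgeSpace (2 * k) →ᵃ[ℝ] (Fin k → Fin k → ℝ),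
      Set.BijOn A F (convexHull ℝ (BQP (Fin k))) ∧
      ∀ z ∈ F, ∀ i j : Fin k, i < j →
        z {ev i, ev j} {ev i, ev j} = A z i j ∧
        z {ev i, ev j} {ev i, od j} = A z i i - A z i j ∧
        z {ev i, ev j} {od i, ev j} = A z j j - A z i j := by
  intro F
  set V : Set (EdgeSpace (2 * k)) := {z | ∃ σ : Equiv.Perm (Fin (2 * k)),
    (∀ i : Fin k, Finset.image σ {od i, ev i} = {od i, ev i}) ∧ z = zMat σ}
  have hVF : F = convexHull ℝ V := by
    ext z
    constructor
    · rintro ⟨hz, h1⟩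
      refine convexHull_mono ?_ (mem_convexHull_sep_of_eq (pairSum k)
        (fun y hy => pairSum_le (subset_convexHull ℝ _ hy)) hz ((pairSum_eq_iff hz).2 h1))
      rintro _ ⟨⟨σ, rfl⟩, h⟩
      rw [pairSum_eq_iff (subset_convexHull ℝ _ ⟨σ, rfl⟩)] at h
      exact ⟨σ, fun i => (zMat_pair_eq_one_iff σ i).1 (h i), rfl⟩
    · intro hz
      have hz' : z ∈ convexHull ℝ (phi (2 * k)) :=
        convexHull_mono (by rintro _ ⟨σ, -, rfl⟩; exact ⟨σ, rfl⟩) hz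
      refine ⟨hz', fun i => ?_⟩
      have hc : Convex ℝ {z : EdgeSpace (2 * k) | entryLin {od i, ev i} {od i, ev i} z = 1} :=
        convex_hyperplane (entryLin _ _).isLinear 1
      exact convexHull_min
        (by rintro _ ⟨σ, h, rfl⟩; exact (zMat_pair_eq_one_iff σ i).2 (h i)) hc hz
  have hVE : ∀ z ∈ V, ∃ σ v, Encodes σ v ∧ z = zMat σ := by
    rintro z ⟨σ, h, rfl⟩
    obtain ⟨v, hv⟩ := (exists_encodes_iff σ).2 h
    exact ⟨σ, v, hv, rfl⟩
  refine ⟨.inr ⟨pairSum k, ?_⟩, hVF, ?_⟩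
  · ext z
    refine and_congr_right fun hz => ?_
    rw [← pairSum_eq_iff hz]
    refine ⟨fun h y hy => h ▸ pairSum_le hy, fun h => (pairSum_le hz).antisymm ?_⟩
    rw [← pairSum_zMat_one]
    exact h _ (subset_convexHull ℝ _ ⟨1, rfl⟩)
  · have : Nontrivial (Fin k) := Fin.nontrivial_iff_two_le.2 hk
    choose p hp using fun i : Fin k => exists_ne i
    obtain ⟨B, hB⟩ := Encodes.exists_affine_zMat (k := k)
    let A := (bqpProj p).toAffineMap
    have hA : ∀ σ v, Encodes σ v → A (zMat σ) = tensorSq v := fun σ v h => h.bqpProj_zMat hp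
    have himg : A '' V = BQP (Fin k) := by
      ext x
      constructor
      · rintro ⟨z, hz, rfl⟩
        obtain ⟨σ, v, h, rfl⟩ := hVE z hz
        exact ⟨v, h.zero_or_one, hA σ v h⟩
      · rintro ⟨v, hv, rfl⟩
        obtain ⟨σ, h⟩ := exists_perm_encodes hv
        exact ⟨zMat σ, ⟨σ, (exists_encodes_iff σ).1 ⟨v, h⟩, rfl⟩, hA σ v h⟩
    have hBA : Set.EqOn (B.comp A) (AffineMap.id ℝ _) F := by
      rw [hVF]
      refine Set.EqOn.affineMap_convexHull fun z hz => ?_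
      obtain ⟨σ, v, h, rfl⟩ := hVE z hz
      simp [hA σ v h, hB σ v h]
    refine ⟨A, ?_, fun z hz i j hij => ?_⟩
    · have hinj : Set.InjOn A F := Set.LeftInvOn.injOn (f₁' := B) fun z hz => hBA hz
      have := hinj.bijOn_image
      rwa [hVF, AffineMap.image_convexHull, himg, ← hVF] at this
    · let C (a b : Fin k) := (entryLin a b).toAffineMap.comp A
      have h1 : Set.EqOn (entryLin {ev i, ev j} {ev i, ev j}).toAffineMap (C i j) F := by
        rw [hVF]
        refine Set.EqOn.affineMap_convexHull fun z hz => ?_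
        obtain ⟨σ, v, h, rfl⟩ := hVE z hz
        simp [C, hA σ v h, (h.zMat_pair hij.ne).1, tensorSq]
      have h2 : Set.EqOn (entryLin {ev i, ev j} {ev i, od j}).toAffineMap ⇑(C i i - C i j) F := by
        rw [hVF]
        refine Set.EqOn.affineMap_convexHull fun z hz => ?_
        obtain ⟨σ, v, h, rfl⟩ := hVE z hz
        rcases h.zero_or_one i with hi | hi <;>
          simp [C, hA σ v h, (h.zMat_pair hij.ne).2.1, tensorSq, hi]
      have h3 : Set.EqOn (entryLin {ev i, ev j} {od i, ev j}).toAffineMap ⇑(C j j - C i j) F := by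
        rw [hVF]
        refine Set.EqOn.affineMap_convexHull fun z hz => ?_
        obtain ⟨σ, v, h, rfl⟩ := hVE z hz
        rcases h.zero_or_one j with hj | hj <;>
          simp [C, hA σ v h, (h.zMat_pair hij.ne).2.2, tensorSq, hj]
      exact ⟨h1 hz, h2 hz, h3 hz⟩
end

section
/- For every n ≥ 3, the polytope conv(φ_3) is affinely isomorphic to a face of conv(φ_n). Concretely, the face of conv(φ_n) cut out by the supporting hyperplanes z_{ijkl} = 0 for all admissible indices with j > 3 and l ≠ j (i.e., the convex hull of the edge-permutation matrices z^σ of those permutations σ of [n] fixing every vertex in {4,5,…,n}) is affinely isomorphic to conv(φ_3). -/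
/-- Points of a convex hull at which a linear functional, nonnegative on the generating set,
vanishes lie in the convex hull of the generators where it vanishes. -/
theorem mem_convexHull_of_functional_eq_zero {E : Type*} [AddCommGroup E] [Module ℝ E]
    {V : Set E} (f : E →ₗ[ℝ] ℝ) (hf : ∀ v ∈ V, 0 ≤ f v) {x : E}
    (hx : x ∈ convexHull ℝ V) (hfx : f x = 0) :
    x ∈ convexHull ℝ {v ∈ V | f v = 0} := by
  set W : Set E := {y | 0 ≤ f y ∧ (f y = 0 → y ∈ convexHull ℝ {v ∈ V | f v = 0})}
  have hconv : Convex ℝ W := by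
    rintro y ⟨hy, hy'⟩ z ⟨hz, hz'⟩ a b ha hb hab
    have hay := mul_nonneg ha hy
    have hbz := mul_nonneg hb hz
    have hval : f (a • y + b • z) = a * f y + b * f z := by simp
    refine ⟨by rw [hval]; positivity, fun h => ?_⟩
    rw [hval] at h
    have h1 : a * f y = 0 := by linarith
    have h2 : b * f z = 0 := by linarith
    rcases mul_eq_zero.1 h1 with rfl | hfy
    · obtain rfl : b = 1 := by linarith
      simpa using hz' (by simpa using h2)
    rcases mul_eq_zero.1 h2 with rfl | hfz
    · obtain rfl : a = 1 := by linarith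
      simpa using hy' hfy
    exact convex_convexHull ℝ _ (hy' hfy) (hz' hfz) ha hb hab
  have hsub : V ⊆ W := fun v hv => ⟨hf v hv, fun h => subset_convexHull ℝ _ ⟨hv, h⟩⟩
  exact (convexHull_min hsub hconv hx).2 hfx

theorem zMat_nonneg {n : ℕ} (σ : Equiv.Perm (Fin n)) (e f : Finset (Fin n)) :
    0 ≤ zMat σ e f := by
  unfold zMat; split_ifs <;> norm_num

theorem nonneg_of_mem_convexHull_phi {n : ℕ} {z : EdgeSpace n} (hz : z ∈ convexHull ℝ (phi n))
    (e f : Finset (Fin n)) : 0 ≤ z e f := by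
  have hconv : Convex ℝ {w : EdgeSpace n | 0 ≤ w e f} := by
    intro x hx y hy a b ha hb _
    exact add_nonneg (mul_nonneg ha hx) (mul_nonneg hb hy)
  have hsub : phi n ⊆ {w : EdgeSpace n | 0 ≤ w e f} := by
    rintro _ ⟨σ, rfl⟩
    exact zMat_nonneg σ e f
  exact convexHull_min hsub hconv hz

/-- The index quadruples of the coordinates required to vanish on the face. -/
def vanishingIndices (n : ℕ) : Finset (Fin n × Fin n × Fin n × Fin n) :=
  {t | t.1 < t.2.1 ∧ t.2.2.1 < t.2.2.2 ∧ 3 ≤ t.2.1.val ∧ t.2.2.2 ≠ t.2.1}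

/-- The sum of the coordinates required to vanish on the face. -/
def vanishingSum (n : ℕ) : EdgeSpace n →ₗ[ℝ] ℝ where
  toFun z := ∑ t ∈ vanishingIndices n, z {t.1, t.2.1} {t.2.2.1, t.2.2.2}
  map_add' x y := by simp [Finset.sum_add_distrib]
  map_smul' a x := by simp [Finset.mul_sum]

theorem vanishingSum_nonneg {n : ℕ} {z : EdgeSpace n} (hz : z ∈ convexHull ℝ (phi n)) :
    0 ≤ vanishingSum n z :=
  Finset.sum_nonneg fun _ _ => nonneg_of_mem_convexHull_phi hz _ _

theorem vanishingSum_eq_zero_iff {n : ℕ} {z : EdgeSpace n} (hz : z ∈ convexHull ℝ (phi n)) :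
    vanishingSum n z = 0 ↔ ∀ i j k l : Fin n, i < j → k < l → 3 ≤ j.val → l ≠ j →
      z {i, j} {k, l} = 0 := by
  refine (Finset.sum_eq_zero_iff_of_nonneg
    fun _ _ => nonneg_of_mem_convexHull_phi hz _ _).trans ?_
  constructor
  · intro h i j k l hij hkl hj hl
    exact h (i, j, k, l) (by simp [vanishingIndices, hij, hkl, hj, hl])
  · rintro h ⟨i, j, k, l⟩ ht
    simp only [vanishingIndices, Finset.mem_filter, Finset.mem_univ, true_and] at ht
    exact h i j k l ht.1 ht.2.1 ht.2.2.1 ht.2.2.2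

theorem val_lt_three_of_fixes {n : ℕ} {σ : Equiv.Perm (Fin n)}
    (h : ∀ v : Fin n, 3 ≤ v.val → σ v = v) {i : Fin n} (hi : i.val < 3) : (σ i).val < 3 := by
  by_contra! hc
  have := σ.injective (h _ hc)
  omega

theorem zMat_vanishes_iff {n : ℕ} (σ : Equiv.Perm (Fin n)) :
    (∀ i j k l : Fin n, i < j → k < l → 3 ≤ j.val → l ≠ j → zMat σ {i, j} {k, l} = 0) ↔
      ∀ v : Fin n, 3 ≤ v.val → σ v = v := by
  constructor
  · intro h j hj
    have key : ∀ i : Fin n, i < j → σ i = j ∨ σ j = j := by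
      intro i hij
      by_contra! hc
      have hne : σ i ≠ σ j := fun h' => hij.ne (σ.injective h')
      have hcard : ({i, j} : Finset (Fin n)).card = 2 := Finset.card_pair hij.ne
      rcases lt_or_gt_of_ne hne with hlt | hlt
      · have := h i j (σ i) (σ j) hij hlt hj hc.2
        simp [zMat, hcard, Finset.image_insert] at this
      · have := h i j (σ j) (σ i) hij hlt hj hc.1
        simp [zMat, hcard, Finset.image_insert, Finset.pair_comm] at this
    have hjn := j.isLt
    rcases key ⟨0, by omega⟩ (Fin.lt_def.2 (by simp; omega)) with h0 | h0
    · rcases key ⟨1, by omega⟩ (Fin.lt_def.2 (by simp; omega)) with h1 | h1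
      · have := σ.injective (h0.trans h1.symm)
        simp at this
      · exact h1
    · exact h0
  · intro h i j k l hij hkl hj hl
    have hlt : σ i < j := by
      by_cases hi : 3 ≤ i.val
      · rwa [h i hi]
      · have := val_lt_three_of_fixes h (not_le.1 hi)
        exact Fin.lt_def.2 (by omega)
    refine if_neg ?_
    rintro ⟨-, he⟩
    rw [Finset.image_insert, Finset.image_singleton, h j hj] at he
    have hl' : l ∈ ({σ i, j} : Finset (Fin n)) := by rw [he]; simp
    have hj' : j ∈ ({k, l} : Finset (Fin n)) := by rw [← he]; simp
    simp only [Finset.mem_insert, Finset.mem_singleton] at hl' hj'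
    rcases hl' with rfl | rfl
    · rcases hj' with rfl | rfl
      · exact lt_asymm hkl hlt
      · exact hl rfl
    · exact hl rfl

/-- `σ` restricts to `τ` on the first three vertices and fixes all others. -/
def Extends {n : ℕ} (hn : 3 ≤ n) (σ : Equiv.Perm (Fin n)) (τ : Equiv.Perm (Fin 3)) : Prop :=
  (∀ i, σ (Fin.castLE hn i) = Fin.castLE hn (τ i)) ∧ ∀ v : Fin n, 3 ≤ v.val → σ v = v

theorem exists_extends_of_fixes {n : ℕ} (hn : 3 ≤ n) {σ : Equiv.Perm (Fin n)}
    (h : ∀ v : Fin n, 3 ≤ v.val → σ v = v) : ∃ τ, Extends hn σ τ := by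
  let g : Fin 3 → Fin 3 := fun i =>
    ⟨σ (Fin.castLE hn i), val_lt_three_of_fixes h (i := Fin.castLE hn i) i.isLt⟩
  have hg : Function.Injective g := by
    intro i j hij
    have hval : (g i).val = (g j).val := congrArg Fin.val hij
    exact Fin.castLE_injective hn (σ.injective (Fin.ext hval))
  exact ⟨Equiv.ofBijective g (Finite.injective_iff_bijective.1 hg), fun _ => rfl, h⟩

theorem exists_extends {n : ℕ} (hn : 3 ≤ n) (τ : Equiv.Perm (Fin 3)) :
    ∃ σ : Equiv.Perm (Fin n), Extends hn σ τ := by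
  refine ⟨τ.viaFintypeEmbedding (Fin.castLEEmb hn), fun i =>
    τ.viaFintypeEmbedding_apply_image (Fin.castLEEmb hn) i, fun v hv => ?_⟩
  refine Equiv.Perm.viaFintypeEmbedding_apply_notMem_range _ _ ?_
  rintro ⟨i, rfl⟩
  have := i.isLt
  simp at hv
  omega

/-- The part of a vertex set inside the first three vertices. -/
def lowPart {n : ℕ} (hn : 3 ≤ n) (e : Finset (Fin n)) : Finset (Fin 3) :=
  {i | Fin.castLE hn i ∈ e}

/-- The part of a vertex set outside the first three vertices. -/
def highPart {n : ℕ} (e : Finset (Fin n)) : Finset (Fin n) := {v ∈ e | 3 ≤ v.val}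

theorem lowPart_map {n : ℕ} (hn : 3 ≤ n) (e : Finset (Fin 3)) :
    lowPart hn (e.map (Fin.castLEEmb hn)) = e := by
  ext i; simp [lowPart]

theorem highPart_map {n : ℕ} (hn : 3 ≤ n) (e : Finset (Fin 3)) :
    highPart (e.map (Fin.castLEEmb hn)) = ∅ := by
  ext v
  simp only [highPart, Finset.mem_filter, Finset.mem_map, Finset.notMem_empty, iff_false]
  rintro ⟨⟨i, -, rfl⟩, hv⟩
  have := i.isLt
  simp at hv
  omega

theorem eq_iff_parts {n : ℕ} (hn : 3 ≤ n) (e f : Finset (Fin n)) :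
    e = f ↔ lowPart hn e = lowPart hn f ∧ highPart e = highPart f := by
  refine ⟨by rintro rfl; simp, fun ⟨hl, hh⟩ => ?_⟩
  ext v
  by_cases hv : 3 ≤ v.val
  · simpa [highPart, hv] using Finset.ext_iff.1 hh v
  · simpa [lowPart] using Finset.ext_iff.1 hl ⟨v, not_le.1 hv⟩

theorem card_lowPart_le {n : ℕ} (hn : 3 ≤ n) (e : Finset (Fin n)) :
    (lowPart hn e).card ≤ e.card := by
  refine Finset.card_le_card_of_injOn (Fin.castLE hn) ?_ (Fin.castLE_injective hn).injOn
  intro i hi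
  simpa [lowPart] using hi

theorem Extends.lowPart_image {n : ℕ} {hn : 3 ≤ n} {σ : Equiv.Perm (Fin n)}
    {τ : Equiv.Perm (Fin 3)} (h : Extends hn σ τ) (e : Finset (Fin n)) :
    lowPart hn (e.image σ) = (lowPart hn e).image τ := by
  ext i
  obtain ⟨k, rfl⟩ := τ.surjective i
  simp only [lowPart, Finset.mem_filter, Finset.mem_univ, true_and, ← h.1 k]
  rw [Function.Injective.mem_finset_image σ.injective,
    Function.Injective.mem_finset_image τ.injective]
  simp

theorem Extends.highPart_image {n : ℕ} {hn : 3 ≤ n} {σ : Equiv.Perm (Fin n)}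
    {τ : Equiv.Perm (Fin 3)} (h : Extends hn σ τ) (e : Finset (Fin n)) :
    highPart (e.image σ) = highPart e := by
  ext v
  simp only [highPart, Finset.mem_filter]
  refine and_congr_left fun hv => ?_
  conv_lhs => rw [← h.2 v hv]
  exact Function.Injective.mem_finset_image σ.injective

theorem Extends.image_eq_iff {n : ℕ} {hn : 3 ≤ n} {σ : Equiv.Perm (Fin n)}
    {τ : Equiv.Perm (Fin 3)} (h : Extends hn σ τ) (e f : Finset (Fin n)) :
    e.image σ = f ↔ (lowPart hn e).image τ = lowPart hn f ∧ highPart e = highPart f := by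
  rw [eq_iff_parts hn, h.lowPart_image, h.highPart_image]

/-- Restriction of an edge matrix to the edges among the first three vertices. -/
def restrictEdges {n : ℕ} (hn : 3 ≤ n) : EdgeSpace n →ₗ[ℝ] EdgeSpace 3 where
  toFun z e f := z (e.map (Fin.castLEEmb hn)) (f.map (Fin.castLEEmb hn))
  map_add' _ _ := rfl
  map_smul' _ _ := rfl

theorem Extends.restrictEdges_zMat {n : ℕ} {hn : 3 ≤ n} {σ : Equiv.Perm (Fin n)}
    {τ : Equiv.Perm (Fin 3)} (h : Extends hn σ τ) : restrictEdges hn (zMat σ) = zMat τ := by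
  funext e f
  simp [restrictEdges, zMat, h.image_eq_iff, lowPart_map, highPart_map]

/-- Extension of an edge matrix on three vertices to `n` vertices: edges with a single vertex
among the first three are read off from the complementary edges. -/
def extendEdges {n : ℕ} (hn : 3 ≤ n) (w : EdgeSpace 3) : EdgeSpace n := fun e f =>
  if e.card = 2 ∧ highPart e = highPart f then
    if (lowPart hn e).card = 2 then w (lowPart hn e) (lowPart hn f)
    else if (lowPart hn e).card = 1 then w (lowPart hn e)ᶜ (lowPart hn f)ᶜ
    else if lowPart hn f = ∅ then 1 else 0
  else 0

theorem extendEdges_combo {n : ℕ} (hn : 3 ≤ n) (x y : EdgeSpace 3) {a b : ℝ} (hab : a + b = 1) :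
    extendEdges hn (a • x + b • y) = a • extendEdges hn x + b • extendEdges hn y := by
  funext e f
  simp only [extendEdges, Pi.add_apply, Pi.smul_apply, smul_eq_mul]
  split_ifs <;> simp [hab]

theorem Extends.extendEdges_zMat {n : ℕ} {hn : 3 ≤ n} {σ : Equiv.Perm (Fin n)}
    {τ : Equiv.Perm (Fin 3)} (h : Extends hn σ τ) : extendEdges hn (zMat τ) = zMat σ := by
  funext e f
  have hcompl : (lowPart hn e)ᶜ.image τ = (lowPart hn f)ᶜ ↔
      (lowPart hn e).image τ = lowPart hn f := by
    rw [← Finset.coe_inj, ← Finset.coe_inj (s₁ := (lowPart hn e).image τ)]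
    push_cast
    rw [Set.image_compl_eq τ.bijective, compl_inj_iff]
  simp only [extendEdges, zMat, h.image_eq_iff, hcompl]
  by_cases he : e.card = 2 ∧ highPart e = highPart f
  swap
  · rw [if_neg he, if_neg (by tauto)]
  rw [if_pos he]
  obtain ⟨he, hh⟩ := he
  by_cases h2 : (lowPart hn e).card = 2
  · simp [h2, he, hh]
  by_cases h1 : (lowPart hn e).card = 1
  · simp [h1, he, hh, Finset.card_compl]
  have h0 : lowPart hn e = ∅ := by
    have := card_lowPart_le hn e
    exact Finset.card_eq_zero.1 (by omega)
  simp [h0, he, hh, eq_comm]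

/-- `conv φ_3` is affinely isomorphic to the face of `conv φ_n` cut out by the
hyperplanes `z_{ijkl} = 0` for admissible `i<j`, `k<l` with `j > 3`, `l ≠ j`
(1-based; here 0-based: `j.val ≥ 3`), i.e. the convex hull of the `z^σ` for
permutations `σ` fixing every vertex in `{4,…,n}` (0-based: `v.val ≥ 3`). -/
theorem phi3_face_of_phi (n : ℕ) (hn : 3 ≤ n) :
    let F : Set (EdgeSpace n) :=
      {z ∈ convexHull ℝ (phi n) |
        ∀ i j k l : Fin n, i < j → k < l → 3 ≤ j.val → l ≠ j →
          z {i, j} {k, l} = 0}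
    IsFaceOf F (convexHull ℝ (phi n)) ∧
    F = convexHull ℝ
      {z | ∃ σ : Equiv.Perm (Fin n), (∀ v : Fin n, 3 ≤ v.val → σ v = v) ∧ z = zMat σ} ∧
    ∃ A : EdgeSpace n →ᵃ[ℝ] EdgeSpace 3,
      Set.BijOn A F (convexHull ℝ (phi 3)) := by
  intro F
  set V : Set (EdgeSpace n) :=
    {z | ∃ σ : Equiv.Perm (Fin n), (∀ v : Fin n, 3 ≤ v.val → σ v = v) ∧ z = zMat σ}
  have hFmem : ∀ z, z ∈ F ↔ z ∈ convexHull ℝ (phi n) ∧ vanishingSum n z = 0 := fun z =>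
    and_congr_right fun hz => (vanishingSum_eq_zero_iff hz).symm
  have hphi : ∀ σ : Equiv.Perm (Fin n), zMat σ ∈ convexHull ℝ (phi n) := fun σ =>
    subset_convexHull ℝ _ ⟨σ, rfl⟩
  have hvanish : ∀ σ : Equiv.Perm (Fin n),
      vanishingSum n (zMat σ) = 0 ↔ ∀ v : Fin n, 3 ≤ v.val → σ v = v := fun σ =>
    (vanishingSum_eq_zero_iff (hphi σ)).trans (zMat_vanishes_iff σ)
  have hVeq : {z ∈ phi n | vanishingSum n z = 0} = V := by
    ext z
    constructor
    · rintro ⟨⟨σ, rfl⟩, h⟩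
      exact ⟨σ, (hvanish σ).1 h, rfl⟩
    · rintro ⟨σ, h, rfl⟩
      exact ⟨⟨σ, rfl⟩, (hvanish σ).2 h⟩
  have hFV : F = convexHull ℝ V := by
    apply Set.Subset.antisymm
    · intro z hz
      obtain ⟨hz, h0⟩ := (hFmem z).1 hz
      rw [← hVeq]
      exact mem_convexHull_of_functional_eq_zero _
        (fun v hv => vanishingSum_nonneg (subset_convexHull ℝ _ hv)) hz h0
    · intro z hz
      rw [← hVeq] at hz
      refine (hFmem z).2 ⟨convexHull_mono (fun _ h => h.1) hz, ?_⟩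
      exact convexHull_min (fun _ h => h.2)
        ((convex_singleton (0 : ℝ)).linear_preimage (vanishingSum n)) hz
  refine ⟨Or.inr ⟨-vanishingSum n, ?_⟩, hFV, (restrictEdges hn).toAffineMap, ?_⟩
  · ext z
    rw [hFmem]
    refine and_congr_right fun hz => ⟨fun h y hy => ?_, fun h => ?_⟩
    · simpa [h] using vanishingSum_nonneg hy
    · have h1 := h _ (hphi 1)
      have h2 := (hvanish 1).2 fun _ _ => rfl
      simp only [LinearMap.neg_apply, h2] at h1
      linarith [vanishingSum_nonneg hz]
  · have himage : (restrictEdges hn) '' V = phi 3 := by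
      ext w
      constructor
      · rintro ⟨_, ⟨σ, h, rfl⟩, rfl⟩
        obtain ⟨τ, hτ⟩ := exists_extends_of_fixes hn h
        exact ⟨τ, hτ.restrictEdges_zMat⟩
      · rintro ⟨τ, rfl⟩
        obtain ⟨σ, hσ⟩ := exists_extends hn τ
        exact ⟨_, ⟨σ, hσ.2, rfl⟩, hσ.restrictEdges_zMat⟩
    have hinv : Set.LeftInvOn (extendEdges hn) (restrictEdges hn) (convexHull ℝ V) := by
      have hconv : Convex ℝ {z | extendEdges hn (restrictEdges hn z) = z} := by
        intro x hx y hy a b _ _ hab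
        simp only [Set.mem_ofPred_eq] at hx hy ⊢
        rw [map_add, map_smul, map_smul, extendEdges_combo hn _ _ hab, hx, hy]
      refine fun z hz => convexHull_min (t := {z | _}) ?_ hconv hz
      rintro _ ⟨σ, h, rfl⟩
      obtain ⟨τ, hτ⟩ := exists_extends_of_fixes hn h
      simp only [Set.mem_ofPred_eq]
      rw [hτ.restrictEdges_zMat, hτ.extendEdges_zMat]
    rw [hFV, ← himage, ← LinearMap.image_convexHull]
    exact hinv.injOn.bijOn_image
end

section
/- For every n ≥ 3, the polytopes conv(QAP(n)) and conv(φ_n) are not affinely isomorphic (even though both have exactly n! vertices): no affine map restricts to a bijection between conv(QAP(n)) and conv(φ_n). -/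
/-- The 0/1 permutation matrix of a permutation. -/
def permMat {n : ℕ} (σ : Equiv.Perm (Fin n)) : Fin n → Fin n → ℝ :=
  fun i j => if σ i = j then 1 else 0

/-- The quadratic assignment polytope vertex set: tensors `y ⊗ y` for permutation matrices. -/
def QAP (n : ℕ) : Set (Fin n → Fin n → Fin n → Fin n → ℝ) :=
  {y | ∃ σ : Equiv.Perm (Fin n), y = fun i j k l => permMat σ i j * permMat σ k l}

/-- `y ⊗ y` for the permutation matrix `y` of `σ`. -/
def qapPoint {n : ℕ} (σ : Equiv.Perm (Fin n)) : Fin n → Fin n → Fin n → Fin n → ℝ :=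
  fun i j k l => permMat σ i j * permMat σ k l

theorem QAP_eq_range (n : ℕ) : QAP n = Set.range (qapPoint (n := n)) := by
  ext y
  exact ⟨fun ⟨σ, h⟩ => ⟨σ, h.symm⟩, fun ⟨σ, h⟩ => ⟨σ, h.symm⟩⟩

theorem phi_eq_range (n : ℕ) : phi n = Set.range (zMat (n := n)) := by
  ext y
  exact ⟨fun ⟨σ, h⟩ => ⟨σ, h.symm⟩, fun ⟨σ, h⟩ => ⟨σ, h.symm⟩⟩

theorem qapPoint_injective (n : ℕ) : Function.Injective (qapPoint (n := n)) := by
  intro σ τ h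
  ext1 i
  have := congrFun (congrFun (congrFun (congrFun h i) (σ i)) i) (σ i)
  by_contra hne
  simp [qapPoint, permMat, Ne.symm hne] at this

theorem zMat_eq_iff {n : ℕ} {σ τ : Equiv.Perm (Fin n)} :
    zMat σ = zMat τ ↔ ∀ e : Finset (Fin n), e.card = 2 → e.image σ = e.image τ := by
  constructor
  · intro h e he
    have := congrFun (congrFun h e) (e.image σ)
    by_contra hne
    simp [zMat, he, Ne.symm hne] at this
  · intro h
    ext e f
    by_cases he : e.card = 2
    · simp [zMat, he, h e he]
    · simp [zMat, he]

theorem zMat_injective {n : ℕ} (hn : 3 ≤ n) : Function.Injective (zMat (n := n)) := by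
  intro σ τ h
  rw [zMat_eq_iff] at h
  ext1 i
  obtain ⟨j, hj⟩ : ∃ j, j ∉ ({i} : Finset (Fin n)) :=
    Finset.exists_mem_notMem_of_card_lt_card (t := Finset.univ) (by simp; omega) |>.imp
      fun _ h => h.2
  obtain ⟨k, hk⟩ : ∃ k, k ∉ ({i, j} : Finset (Fin n)) :=
    Finset.exists_mem_notMem_of_card_lt_card (t := Finset.univ)
      (by have := Finset.card_le_two (a := i) (b := j); simp; omega) |>.imp fun _ h => h.2
  simp only [Finset.mem_singleton, Finset.mem_insert, not_or] at hj hk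
  have h₁ : σ i ∈ ({i, j} : Finset (Fin n)).image τ := by
    rw [← h _ (Finset.card_pair (Ne.symm hj))]; simp
  have h₂ : σ i ∈ ({i, k} : Finset (Fin n)).image τ := by
    rw [← h _ (Finset.card_pair (Ne.symm hk.1))]; simp
  simp only [Finset.image_insert, Finset.image_singleton, Finset.mem_insert,
    Finset.mem_singleton] at h₁ h₂
  rcases h₁ with h₁ | h₁
  · exact h₁
  · rcases h₂ with h₂ | h₂
    · exact h₂
    · exact absurd (τ.injective (h₂.symm.trans h₁)) hk.2

theorem ncard_range_perm {n : ℕ} {E : Type*} {f : Equiv.Perm (Fin n) → E}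
    (hf : Function.Injective f) : (Set.range f).ncard = n.factorial := by
  rw [← Set.image_univ, Set.ncard_image_of_injective _ hf, Set.ncard_univ, Nat.card_eq_fintype_card,
    Fintype.card_perm, Fintype.card_fin]

/-- The linear map sending `y ⊗ y` to the edge-permutation matrix of the same permutation:
for `e = {i, k}` and `f = {j, l}`, the `(e, f)` entry is `y_{ij} y_{kl} + y_{il} y_{kj}`. -/
noncomputable def symmetrize (n : ℕ) :
    (Fin n → Fin n → Fin n → Fin n → ℝ) →ₗ[ℝ] EdgeSpace n where
  toFun y e f := ∑ i, ∑ j, ∑ k, ∑ l,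
    if e.card = 2 ∧ e = {i, k} ∧ f = {j, l} then y i j k l / 2 else 0
  map_add' x y := by
    ext e f
    simp only [Pi.add_apply, ← Finset.sum_add_distrib]
    refine Finset.sum_congr rfl fun i _ => Finset.sum_congr rfl fun j _ =>
      Finset.sum_congr rfl fun k _ => Finset.sum_congr rfl fun l _ => ?_
    split_ifs <;> ring
  map_smul' c y := by
    ext e f
    simp only [Pi.smul_apply, smul_eq_mul, RingHom.id_apply, Finset.mul_sum]
    refine Finset.sum_congr rfl fun i _ => Finset.sum_congr rfl fun j _ =>
      Finset.sum_congr rfl fun k _ => Finset.sum_congr rfl fun l _ => ?_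
    split_ifs <;> ring

theorem symmetrize_qapPoint {n : ℕ} (σ : Equiv.Perm (Fin n)) :
    symmetrize n (qapPoint σ) = zMat σ := by
  ext e f
  have key : symmetrize n (qapPoint σ) e f =
      ∑ i, ∑ k, if e.card = 2 ∧ e = {i, k} ∧ f = {σ i, σ k} then (1 / 2 : ℝ) else 0 := by
    simp only [symmetrize, LinearMap.coe_mk, AddHom.coe_mk]
    refine Finset.sum_congr rfl fun i _ => ?_
    rw [Finset.sum_comm]
    refine Finset.sum_congr rfl fun k _ => ?_
    rw [Finset.sum_eq_single (σ i), Finset.sum_eq_single (σ k)]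
    · simp [qapPoint, permMat]
    · intro l _ hl
      simp [qapPoint, permMat, Ne.symm hl]
    · simp
    · intro j _ hj
      simp [qapPoint, permMat, Ne.symm hj]
    · simp
  rw [key]
  by_cases he : e.card = 2
  · obtain ⟨a, b, hab, rfl⟩ := Finset.card_eq_two.1 he
    have hpair : ∀ i k : Fin n, ({a, b} : Finset (Fin n)) = {i, k} ↔
        (i = a ∧ k = b) ∨ (i = b ∧ k = a) := by
      intro i k
      rw [← Finset.coe_inj]
      push_cast
      rw [Set.pair_eq_pair_iff]
      grind
    have hsplit : ∀ i k : Fin n,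
        (if ({a, b} : Finset (Fin n)).card = 2 ∧ ({a, b} : Finset (Fin n)) = {i, k} ∧
          f = {σ i, σ k} then (1 / 2 : ℝ) else 0) =
        (if i = a then if k = b then if f = {σ a, σ b} then (1 / 2 : ℝ) else 0 else 0 else 0) +
        (if i = b then if k = a then if f = {σ a, σ b} then (1 / 2 : ℝ) else 0 else 0 else 0) := by
      intro i k
      have hc := Finset.pair_comm (σ a) (σ b)
      simp only [hpair]
      by_cases h₁ : i = a <;> by_cases h₂ : k = b <;> by_cases h₃ : i = b <;>
        by_cases h₄ : k = a <;> grind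
    simp only [hsplit, Finset.sum_add_distrib]
    simp only [zMat, he, true_and, Finset.image_insert, Finset.image_singleton,
      eq_comm (b := f)]
    simp only [Finset.sum_ite_irrel, Finset.sum_const_zero, Finset.sum_ite_eq', Finset.mem_univ,
      if_true]
    split_ifs <;> norm_num
  · simp [zMat, he]

/-- The permutation of `Fin n` acting as `σ` on the first three points. -/
noncomputable def extendPerm {n : ℕ} (hn : 3 ≤ n) : Equiv.Perm (Fin 3) →* Equiv.Perm (Fin n) :=
  Equiv.Perm.viaEmbeddingHom (Fin.castLEEmb hn)

theorem extendPerm_castLE {n : ℕ} (hn : 3 ≤ n) (σ : Equiv.Perm (Fin 3)) (i : Fin 3) :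
    extendPerm hn σ (Fin.castLE hn i) = Fin.castLE hn (σ i) :=
  Equiv.Perm.viaEmbedding_apply σ (Fin.castLEEmb hn) i

theorem extendPerm_of_notMem_range {n : ℕ} (hn : 3 ≤ n) (σ : Equiv.Perm (Fin 3)) (x : Fin n)
    (hx : x ∉ Set.range (Fin.castLE hn)) : extendPerm hn σ x = x :=
  Equiv.Perm.viaEmbedding_apply_of_notMem σ (Fin.castLEEmb hn) x hx

/-- A transposition of the first three points preserving `e`, by the pigeonhole principle. -/
theorem exists_swap_image_eq {n : ℕ} (hn : 3 ≤ n) (e : Finset (Fin n)) :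
    ∃ τ : Equiv.Perm (Fin 3), Equiv.Perm.sign τ = -1 ∧ e.image (extendPerm hn τ) = e := by
  obtain ⟨i, j, hij, h⟩ : ∃ i j : Fin 3, i ≠ j ∧
      (Fin.castLE hn i ∈ e ↔ Fin.castLE hn j ∈ e) := by
    by_cases h₀ : Fin.castLE hn 0 ∈ e <;> by_cases h₁ : Fin.castLE hn 1 ∈ e <;>
      by_cases h₂ : Fin.castLE hn 2 ∈ e <;>
      first
      | exact ⟨0, 1, by decide, by tauto⟩
      | exact ⟨0, 2, by decide, by tauto⟩
      | exact ⟨1, 2, by decide, by tauto⟩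
  refine ⟨Equiv.swap i j, Equiv.Perm.sign_swap hij, ?_⟩
  apply Finset.eq_of_subset_of_card_le
  · intro y hy
    obtain ⟨x, hx, rfl⟩ := Finset.mem_image.1 hy
    by_cases hr : x ∈ Set.range (Fin.castLE hn)
    · obtain ⟨k, rfl⟩ := hr
      rw [extendPerm_castLE, Equiv.swap_apply_def]
      split_ifs with h₁ h₂
      · subst h₁; exact h.1 hx
      · subst h₂; exact h.2 hx
      · exact hx
    · rwa [extendPerm_of_notMem_range hn _ _ hr]
  · rw [Finset.card_image_of_injective _ (extendPerm hn _).injective]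

theorem sum_sign_zMat {n : ℕ} (hn : 3 ≤ n) :
    ∑ σ : Equiv.Perm (Fin 3), ((Equiv.Perm.sign σ : ℤ) : ℝ) • zMat (extendPerm hn σ) = 0 := by
  ext e f
  obtain ⟨τ, hτ, he⟩ := exists_swap_image_eq hn e
  have hinv : ∀ σ, zMat (extendPerm hn (σ * τ)) e f = zMat (extendPerm hn σ) e f := by
    intro σ
    have : e.image (extendPerm hn (σ * τ)) = e.image (extendPerm hn σ) := by
      conv_rhs => rw [← he]
      rw [Finset.image_image, map_mul, Equiv.Perm.coe_mul]
    simp only [zMat, this]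
  simp only [Finset.sum_apply, Pi.smul_apply, smul_eq_mul, Pi.zero_apply]
  have := Equiv.sum_comp (Equiv.mulRight τ) fun σ : Equiv.Perm (Fin 3) =>
    ((Equiv.Perm.sign σ : ℤ) : ℝ) * zMat (extendPerm hn σ) e f
  simp only [Equiv.coe_mulRight, hinv, Equiv.Perm.sign_mul, hτ] at this
  simp only [mul_neg, mul_one, Units.val_neg, Int.cast_neg, neg_mul, Finset.sum_neg_distrib] at this
  linarith

theorem sum_sign_qapPoint_ne_zero {n : ℕ} (hn : 3 ≤ n) :
    ∑ σ : Equiv.Perm (Fin 3), ((Equiv.Perm.sign σ : ℤ) : ℝ) • qapPoint (extendPerm hn σ) ≠ 0 := by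
  intro h
  have h' := congrFun (congrFun (congrFun (congrFun h (Fin.castLE hn 0)) (Fin.castLE hn 0))
    (Fin.castLE hn 1)) (Fin.castLE hn 1)
  simp only [Finset.sum_apply, Pi.smul_apply, smul_eq_mul, Pi.zero_apply, qapPoint, permMat,
    extendPerm_castLE, (Fin.castLE_injective hn).eq_iff] at h'
  rw [Finset.sum_eq_single 1] at h'
  · simp at h'
  · intro σ _ hσ
    have : ¬ (σ 0 = 0 ∧ σ 1 = 1) := by revert σ; decide
    split_ifs <;> simp_all
  · simp

theorem sum_sign_qapPoint_mem {n : ℕ} (hn : 3 ≤ n) :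
    ∑ σ : Equiv.Perm (Fin 3), ((Equiv.Perm.sign σ : ℤ) : ℝ) • qapPoint (extendPerm hn σ) ∈
      vectorSpan ℝ (QAP n) := by
  have hsum : ∑ σ : Equiv.Perm (Fin 3), ((Equiv.Perm.sign σ : ℤ) : ℝ) = 0 := by
    have : ∑ σ : Equiv.Perm (Fin 3), (Equiv.Perm.sign σ : ℤ) = 0 := by decide
    exact_mod_cast this
  have : ∑ σ : Equiv.Perm (Fin 3), ((Equiv.Perm.sign σ : ℤ) : ℝ) • qapPoint (extendPerm hn σ) =
      ∑ σ : Equiv.Perm (Fin 3), ((Equiv.Perm.sign σ : ℤ) : ℝ) •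
        (qapPoint (extendPerm hn σ) -ᵥ qapPoint 1) := by
    simp only [vsub_eq_sub, smul_sub, Finset.sum_sub_distrib, ← Finset.sum_smul, hsum, zero_smul,
      sub_zero]
  rw [this]
  exact Submodule.sum_mem _ fun σ _ => Submodule.smul_mem _ _
    (vsub_mem_vectorSpan ℝ ⟨_, rfl⟩ ⟨_, rfl⟩)

theorem finrank_vectorSpan_phi_lt {n : ℕ} (hn : 3 ≤ n) :
    Module.finrank ℝ (vectorSpan ℝ (phi n)) < Module.finrank ℝ (vectorSpan ℝ (QAP n)) := by
  have himage : phi n = (symmetrize n).toAffineMap '' QAP n := by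
    rw [phi_eq_range, QAP_eq_range, ← Set.range_comp]
    congr 1
    ext1 σ
    exact (symmetrize_qapPoint σ).symm
  set W := vectorSpan ℝ (QAP n)
  have hW : vectorSpan ℝ (phi n) = ((symmetrize n).domRestrict W).range := by
    rw [himage, ← AffineMap.map_vectorSpan, LinearMap.range_domRestrict]
    rfl
  have hker : 0 < Module.finrank ℝ ((symmetrize n).domRestrict W).ker := by
    refine (Module.finrank_pos_iff_exists_ne_zero (R := ℝ)
      (M := ((symmetrize n).domRestrict W).ker)).2 ⟨⟨⟨_, sum_sign_qapPoint_mem hn⟩, ?_⟩, ?_⟩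
    · simp only [LinearMap.mem_ker, LinearMap.domRestrict_apply, map_sum, map_smul,
        symmetrize_qapPoint]
      exact sum_sign_zMat hn
    · intro h
      exact sum_sign_qapPoint_ne_zero hn (congrArg Subtype.val (congrArg Subtype.val h))
  have := ((symmetrize n).domRestrict W).finrank_range_add_finrank_ker
  rw [hW]
  exact (Nat.lt_add_of_pos_right hker).trans_eq this

theorem vectorSpan_convexHull {E : Type*} [AddCommGroup E] [Module ℝ E] (s : Set E) :
    vectorSpan ℝ (convexHull ℝ s) = vectorSpan ℝ s := by
  rw [← direction_affineSpan, affineSpan_convexHull, direction_affineSpan]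

theorem Convex.exists_smul_sub_of_mem_vectorSpan {E : Type*} [AddCommGroup E] [Module ℝ E]
    {s : Set E} (hs : Convex ℝ s) (hne : s.Nonempty) {v : E} (hv : v ∈ vectorSpan ℝ s) :
    ∃ t : ℝ, 0 ≤ t ∧ ∃ x ∈ s, ∃ y ∈ s, v = t • (x - y) := by
  obtain ⟨p, hp⟩ := hne
  induction hv using Submodule.span_induction with
  | mem v hv =>
    obtain ⟨x, hx, y, hy, rfl⟩ := Set.mem_vsub.1 hv
    exact ⟨1, zero_le_one, x, hx, y, hy, by simp⟩
  | zero => exact ⟨0, le_rfl, p, hp, p, hp, by simp⟩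
  | add v w _ _ ihv ihw =>
    obtain ⟨a, ha, x, hx, y, hy, rfl⟩ := ihv
    obtain ⟨b, hb, x', hx', y', hy', rfl⟩ := ihw
    rcases (add_nonneg ha hb).eq_or_lt with h | h
    · obtain rfl : a = 0 := by linarith
      obtain rfl : b = 0 := by linarith
      exact ⟨0, le_rfl, p, hp, p, hp, by simp⟩
    · have hab : a / (a + b) + b / (a + b) = 1 := by field_simp
      refine ⟨a + b, h.le, _, hs hx hx' (by positivity) (by positivity) hab,
        _, hs hy hy' (by positivity) (by positivity) hab, ?_⟩
      simp only [smul_sub, smul_add, smul_smul, mul_div_cancel₀ _ h.ne']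
      abel
  | smul c v _ ih =>
    obtain ⟨a, ha, x, hx, y, hy, rfl⟩ := ih
    rcases le_total 0 c with hc | hc
    · exact ⟨c * a, mul_nonneg hc ha, x, hx, y, hy, by rw [smul_smul]⟩
    · refine ⟨-c * a, mul_nonneg (neg_nonneg.2 hc) ha, y, hy, x, hx, ?_⟩
      rw [smul_smul, ← neg_sub x y, smul_neg, neg_mul, neg_smul, neg_neg]

theorem Convex.finrank_vectorSpan_image {E F : Type*} [AddCommGroup E] [Module ℝ E]
    [AddCommGroup F] [Module ℝ F] {s : Set E} (hs : Convex ℝ s) {f : E →ᵃ[ℝ] F}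
    (hf : Set.InjOn f s) :
    Module.finrank ℝ (vectorSpan ℝ (f '' s)) = Module.finrank ℝ (vectorSpan ℝ s) := by
  rcases s.eq_empty_or_nonempty with rfl | hne
  · rw [Set.image_empty, vectorSpan_empty, vectorSpan_empty, finrank_bot, finrank_bot]
  have hinj : Function.Injective (f.linear.domRestrict (vectorSpan ℝ s)) := by
    rw [← LinearMap.ker_eq_bot, LinearMap.ker_eq_bot']
    rintro ⟨v, hv⟩ h
    obtain ⟨t, -, x, hx, y, hy, rfl⟩ := hs.exists_smul_sub_of_mem_vectorSpan hne hv
    rw [LinearMap.domRestrict_apply, map_smul, ← vsub_eq_sub, f.linearMap_vsub, vsub_eq_sub,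
      smul_eq_zero] at h
    ext1
    rcases h with h | h
    · simp [h]
    · simp [hf hx hy (sub_eq_zero.1 h)]
  rw [← AffineMap.map_vectorSpan, ← LinearMap.range_domRestrict,
    LinearMap.finrank_range_of_inj hinj]

theorem finrank_vectorSpan_eq_of_bijOn_convexHull {E F : Type*} [AddCommGroup E] [Module ℝ E]
    [AddCommGroup F] [Module ℝ F] {s : Set E} {t : Set F} {f : E →ᵃ[ℝ] F}
    (hf : Set.BijOn f (convexHull ℝ s) (convexHull ℝ t)) :
    Module.finrank ℝ (vectorSpan ℝ t) = Module.finrank ℝ (vectorSpan ℝ s) := by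
  rw [← vectorSpan_convexHull t, ← hf.image_eq,
    (convex_convexHull ℝ s).finrank_vectorSpan_image hf.injOn, vectorSpan_convexHull]

/-- `conv QAP(n)` and `conv φ_n` both have `n!` vertices but are not affinely
isomorphic: no affine map restricts to a bijection between them (in either
direction). -/
theorem qap_not_iso_phi (n : ℕ) (hn : 3 ≤ n) :
    (QAP n).ncard = Nat.factorial n ∧ (phi n).ncard = Nat.factorial n ∧
    (¬ ∃ A : (Fin n → Fin n → Fin n → Fin n → ℝ) →ᵃ[ℝ] EdgeSpace n,
      Set.BijOn A (convexHull ℝ (QAP n)) (convexHull ℝ (phi n))) ∧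
    (¬ ∃ B : EdgeSpace n →ᵃ[ℝ] (Fin n → Fin n → Fin n → Fin n → ℝ),
      Set.BijOn B (convexHull ℝ (phi n)) (convexHull ℝ (QAP n))) := by
  have hlt := finrank_vectorSpan_phi_lt hn
  refine ⟨?_, ?_, ?_, ?_⟩
  · rw [QAP_eq_range, ncard_range_perm (qapPoint_injective n)]
  · rw [phi_eq_range, ncard_range_perm (zMat_injective hn)]
  · rintro ⟨A, hA⟩
    exact hlt.ne (finrank_vectorSpan_eq_of_bijOn_convexHull hA)
  · rintro ⟨B, hB⟩
    exact hlt.ne' (finrank_vectorSpan_eq_of_bijOn_convexHull hB)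
end

section
/- For every n ≥ 3, the polytope conv(φ_n) is not 3-neighborly: there exist three distinct vertices of conv(φ_n) (three distinct edge-permutation matrices) whose set is not the vertex set of any face of conv(φ_n). -/
/-- `S` is the vertex set of some face of `conv V`: there is a face `F` whose
set of vertices (= the points of `V` it contains) is exactly `S`. -/
def IsVertexSetOfFace {E : Type*} [AddCommGroup E] [Module ℝ E]
    (V S : Set E) : Prop :=
  ∃ F, IsFaceOf F (convexHull ℝ V) ∧ F ∩ V = S

open Equiv in
/-- For three points `a`, `b`, `c`, the sum of `z^σ` over the even permutations of `{a, b, c}`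
equals the sum over the odd ones. -/
theorem zMat_even_sum_eq_odd_sum {n : ℕ} {a b c : Fin n} (hab : a ≠ b) (hac : a ≠ c)
    (hbc : b ≠ c) :
    zMat 1 + zMat (swap a b * swap b c) + zMat (swap b c * swap a b) =
      zMat (swap a b) + zMat (swap b c) + zMat (swap a c) := by
  funext e f
  by_cases he : e.card = 2
  · obtain ⟨x, y, hxy, rfl⟩ := Finset.card_eq_two.mp he
    have fixed : ∀ z, z ≠ a → z ≠ b → z ≠ c →
        swap a b z = z ∧ swap b c z = z ∧ swap a c z = z := fun z ha hb hc =>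
      ⟨swap_apply_of_ne_of_ne ha hb, swap_apply_of_ne_of_ne hb hc, swap_apply_of_ne_of_ne ha hc⟩
    have key : ∀ z, z = a ∨ z = b ∨ z = c ∨ (z ≠ a ∧ z ≠ b ∧ z ≠ c) := by
      intro z; tauto
    have h₁ : swap a b c = c := swap_apply_of_ne_of_ne hac.symm hbc.symm
    have h₂ : swap b c a = a := swap_apply_of_ne_of_ne hab hac
    have h₃ : swap a c b = b := swap_apply_of_ne_of_ne hab.symm hbc
    simp only [Pi.add_apply, zMat, he, true_and, Finset.image_insert, Finset.image_singleton,
      Perm.mul_apply, Perm.one_apply]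
    rcases key x with rfl | rfl | rfl | ⟨hxa, hxb, hxc⟩ <;>
    rcases key y with rfl | rfl | rfl | ⟨hya, hyb, hyc⟩ <;>
    first
    | exact absurd rfl hxy
    | (simp_all only [swap_apply_left, swap_apply_right, ne_eq, not_false_eq_true,
        Finset.pair_comm]
       try ring)
  · simp [zMat, he]

/-- A permutation is determined at a vertex by its edge-permutation matrix. -/
theorem zMat_apply_eq {n : ℕ} {σ τ : Equiv.Perm (Fin n)} (h : zMat σ = zMat τ) {i j k : Fin n}
    (hij : i ≠ j) (hik : i ≠ k) (hjk : j ≠ k) : σ i = τ i := by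
  have edge : ∀ x y, x ≠ y → ({σ x, σ y} : Finset (Fin n)) = {τ x, τ y} := by
    intro x y hxy
    have := congrFun (congrFun h {x, y}) {σ x, σ y}
    simp only [zMat, Finset.card_pair hxy, Finset.image_insert, Finset.image_singleton,
      true_and, if_true] at this
    by_contra hne
    rw [if_neg (Ne.symm hne)] at this
    exact one_ne_zero this
  have hj : σ i ∈ ({τ i, τ j} : Finset (Fin n)) := by simp [← edge i j hij]
  have hk : σ i ∈ ({τ i, τ k} : Finset (Fin n)) := by simp [← edge i k hik]
  have hne : τ j ≠ τ k := τ.injective.ne hjk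
  simp only [Finset.mem_insert, Finset.mem_singleton] at hj hk
  grind

/-- If three points of `V` have the same sum as three other points of `V`, then every face of
`conv V` containing the former contains the latter. -/
theorem IsFaceOf.mem_of_sum_eq {E : Type*} [AddCommGroup E] [Module ℝ E] {S F : Set E}
    (hF : IsFaceOf F S) {x₁ x₂ x₃ y₁ y₂ y₃ : E} (hx₁ : x₁ ∈ F) (hx₂ : x₂ ∈ F) (hx₃ : x₃ ∈ F)
    (hy₁ : y₁ ∈ S) (hy₂ : y₂ ∈ S) (hy₃ : y₃ ∈ S) (h : x₁ + x₂ + x₃ = y₁ + y₂ + y₃) :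
    y₂ ∈ F := by
  obtain rfl | ⟨φ, rfl⟩ := hF
  · exact hy₂
  · refine ⟨hy₂, fun y hy => ?_⟩
    have hsum := congrArg φ h
    simp only [map_add] at hsum
    have := hx₁.2 y hy
    have := hx₂.2 y₁ hy₁
    have := hx₃.2 y₃ hy₃
    linarith

/-- `conv φ_n` is not 3-neighborly: some three distinct vertices do not form
the vertex set of any face. -/
theorem phi_not_three_neighborly (n : ℕ) (hn : 3 ≤ n) :
    ∃ z₁ z₂ z₃ : EdgeSpace n,
      z₁ ∈ phi n ∧ z₂ ∈ phi n ∧ z₃ ∈ phi n ∧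
      z₁ ≠ z₂ ∧ z₁ ≠ z₃ ∧ z₂ ≠ z₃ ∧
      ¬ IsVertexSetOfFace (phi n) {z₁, z₂, z₃} := by
  obtain ⟨a, b, c, hab, hac, hbc⟩ : ∃ a b c : Fin n, a ≠ b ∧ a ≠ c ∧ b ≠ c :=
    ⟨⟨0, by lia⟩, ⟨1, by lia⟩, ⟨2, by lia⟩, by simp, by simp, by simp⟩
  have h₂ : Equiv.swap b c a = a := Equiv.swap_apply_of_ne_of_ne hab hac
  refine ⟨zMat 1, zMat (Equiv.swap a b * Equiv.swap b c), zMat (Equiv.swap b c * Equiv.swap a b),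
    ⟨_, rfl⟩, ⟨_, rfl⟩, ⟨_, rfl⟩, fun h => ?_, fun h => ?_, fun h => ?_, ?_⟩
  · simpa [h₂, hab] using zMat_apply_eq h hab hac hbc
  · simpa [hac] using zMat_apply_eq h hab hac hbc
  · simpa [h₂, hbc] using zMat_apply_eq h hab hac hbc
  · rintro ⟨F, hF, hFV⟩
    have mem_F : ∀ z ∈ F ∩ phi n, z ∈ F := fun _ hz => hz.1
    rw [hFV] at mem_F
    have mem_hull : ∀ σ : Equiv.Perm (Fin n), zMat σ ∈ convexHull ℝ (phi n) :=
      fun σ => subset_convexHull ℝ _ ⟨σ, rfl⟩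
    have hodd : zMat (Equiv.swap b c) ∈ F ∩ phi n :=
      ⟨hF.mem_of_sum_eq (mem_F _ (by simp)) (mem_F _ (by simp)) (mem_F _ (by simp))
        (mem_hull _) (mem_hull _) (mem_hull _) (zMat_even_sum_eq_odd_sum hab hac hbc), _, rfl⟩
    rw [hFV] at hodd
    rcases hodd with h | h | h
    · simpa [hbc.symm] using zMat_apply_eq h hab.symm hbc hac
    · simpa [h₂, hab] using zMat_apply_eq h hab hac hbc
    · simpa [h₂, hac] using zMat_apply_eq h hab hac hbc
end

section
/- For every n ≥ 2, the Boolean quadratic polytope conv(BQP(n)) is 3-neighborly: every set of at most three distinct points of BQP(n) is the vertex set of a face of conv(BQP(n)). -/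
/-- A finite set `V` with nonempty `S ⊆ V` has a face with vertex set `S` as soon as every point of
`V \ S` is separated from `S` by some linear inequality valid on `V` and tight on `S`. -/
theorem isVertexSetOfFace_of_forall_exists {E : Type*} [AddCommGroup E] [Module ℝ E]
    {V S : Set E} (hV : V.Finite) (hSV : S ⊆ V) (hS : S.Nonempty)
    (h : ∀ p ∈ V \ S, ∃ φ : E →ₗ[ℝ] ℝ, ∃ c : ℝ,
      (∀ v ∈ V, φ v ≤ c) ∧ (∀ s ∈ S, φ s = c) ∧ φ p < c) :
    IsVertexSetOfFace V S := by
  choose! φ c hle heq hlt using h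
  have hfin : (V \ S).Finite := hV.subset Set.sdiff_subset
  set Φ : E →ₗ[ℝ] ℝ := ∑ p ∈ hfin.toFinset, φ p with hΦ
  set C : ℝ := ∑ p ∈ hfin.toFinset, c p with hC
  have hΦle : ∀ v ∈ V, Φ v ≤ C := fun v hv => by
    rw [hΦ, LinearMap.sum_apply]
    exact Finset.sum_le_sum fun p hp => hle p (hfin.mem_toFinset.1 hp) v hv
  have hΦeq : ∀ s ∈ S, Φ s = C := fun s hs => by
    rw [hΦ, LinearMap.sum_apply]
    exact Finset.sum_congr rfl fun p hp => heq p (hfin.mem_toFinset.1 hp) s hs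
  have hΦlt : ∀ p ∈ V \ S, Φ p < C := fun p hp => by
    rw [hΦ, LinearMap.sum_apply]
    exact Finset.sum_lt_sum (fun q hq => hle q (hfin.mem_toFinset.1 hq) p hp.1)
      ⟨p, hfin.mem_toFinset.2 hp, hlt p hp⟩
  have hconv : ∀ y ∈ convexHull ℝ V, Φ y ≤ C := fun y hy =>
    convexHull_min (t := {y | Φ y ≤ C}) hΦle (convex_halfSpace_le Φ.isLinear C) hy
  refine ⟨_, Or.inr ⟨Φ, rfl⟩, ?_⟩
  ext x
  constructor
  · rintro ⟨⟨-, hmax⟩, hxV⟩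
    by_contra hxS
    obtain ⟨s, hs⟩ := hS
    have := hmax s (subset_convexHull ℝ V (hSV hs))
    rw [hΦeq s hs] at this
    exact absurd (hΦlt x ⟨hxV, hxS⟩) this.not_gt
  · intro hx
    refine ⟨⟨subset_convexHull ℝ V (hSV hx), fun y hy => ?_⟩, hSV hx⟩
    rw [hΦeq x hx]
    exact hconv y hy

theorem BQP_finite (α : Type*) [Fintype α] : (BQP α).Finite := by
  have h : (Set.univ.pi fun _ : α => ({0, 1} : Set ℝ)).Finite :=
    Set.Finite.pi fun _ => Set.toFinite _
  refine (h.image fun v i j => v i * v j).subset ?_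
  rintro x ⟨v, hv, rfl⟩
  exact ⟨v, fun i _ => hv i, rfl⟩

/-- The functions which agree on 0/1 vectors with an affine function of `v ⊗ v`. -/
def quadraticFunctions (α : Type*) : Submodule ℝ ((α → ℝ) → ℝ) where
  carrier := {f | ∃ φ : (α → α → ℝ) →ₗ[ℝ] ℝ, ∃ c : ℝ,
    ∀ v : α → ℝ, (∀ i, v i = 0 ∨ v i = 1) → f v = φ (fun i j => v i * v j) + c}
  zero_mem' := ⟨0, 0, by simp⟩
  add_mem' := by
    rintro f g ⟨φ, c, hf⟩ ⟨ψ, d, hg⟩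
    refine ⟨φ + ψ, c + d, fun v hv => ?_⟩
    rw [Pi.add_apply, hf v hv, hg v hv, LinearMap.add_apply]
    ring
  smul_mem' := by
    rintro r f ⟨φ, c, hf⟩
    refine ⟨r • φ, r * c, fun v hv => ?_⟩
    rw [Pi.smul_apply, hf v hv, LinearMap.smul_apply, smul_eq_mul, smul_eq_mul]
    ring

section

variable {α : Type*}

theorem const_mem_quadraticFunctions (c : ℝ) : (fun _ => c) ∈ quadraticFunctions α :=
  ⟨0, c, by simp⟩

theorem mul_mem_quadraticFunctions (i j : α) :
    (fun v => v i * v j) ∈ quadraticFunctions α :=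
  ⟨(LinearMap.proj (R := ℝ) (φ := fun _ : α => ℝ) j).comp
    (LinearMap.proj (R := ℝ) (φ := fun _ : α => α → ℝ) i), 0, by simp⟩

theorem apply_mem_quadraticFunctions (i : α) : (fun v => v i) ∈ quadraticFunctions α :=
  ⟨(LinearMap.proj (R := ℝ) (φ := fun _ : α => ℝ) i).comp
    (LinearMap.proj (R := ℝ) (φ := fun _ : α => α → ℝ) i), 0, fun v hv => by
    rcases hv i with h | h <;> simp [h]⟩

theorem affine_mul_affine_mem_quadraticFunctions (i j : α) (a b c d : ℝ) :
    (fun v => (a + b * v i) * (c + d * v j)) ∈ quadraticFunctions α := by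
  have h := add_mem (add_mem (const_mem_quadraticFunctions (α := α) (a * c))
    (Submodule.smul_mem _ (a * d) (apply_mem_quadraticFunctions j)))
    (add_mem (Submodule.smul_mem _ (b * c) (apply_mem_quadraticFunctions i))
    (Submodule.smul_mem _ (b * d) (mul_mem_quadraticFunctions i j)))
  convert h using 1
  ext v
  simp only [Pi.add_apply, Pi.smul_apply, smul_eq_mul]
  ring

/-- A 0/1 vector `x` outside `{a, b, c}` is separated from `a, b, c` by a quadratic function that is
nonnegative on all 0/1 vectors. -/
theorem exists_mem_quadraticFunctions_separating {x a b c : α → ℝ}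
    (hx : ∀ i, x i = 0 ∨ x i = 1) (ha : ∀ i, a i = 0 ∨ a i = 1)
    (hb : ∀ i, b i = 0 ∨ b i = 1) (hc : ∀ i, c i = 0 ∨ c i = 1)
    (hxa : x ≠ a) (hxb : x ≠ b) (hxc : x ≠ c) :
    ∃ f ∈ quadraticFunctions α, (∀ v, (∀ i, v i = 0 ∨ v i = 1) → 0 ≤ f v) ∧
      f a = 0 ∧ f b = 0 ∧ f c = 0 ∧ 0 < f x := by
  -- `z v i` is `1` if `v` and `x` differ at `i`, and `0` otherwise.
  let z : (α → ℝ) → α → ℝ := fun v i => x i + (1 - 2 * x i) * v i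
  have z_bin {v : α → ℝ} (hv : ∀ i, v i = 0 ∨ v i = 1) (i : α) : z v i = 0 ∨ z v i = 1 := by
    rcases hx i with h | h <;> rcases hv i with h' | h' <;> norm_num [z, h, h']
  have z_self (i : α) : z x i = 0 := by
    rcases hx i with h | h <;> norm_num [z, h]
  have z_ne {v : α → ℝ} (hv : ∀ i, v i = 0 ∨ v i = 1) (hne : x ≠ v) : ∃ i, z v i = 1 := by
    obtain ⟨i, hi⟩ := Function.ne_iff.1 hne
    refine ⟨i, ?_⟩
    rcases hx i with h | h <;> rcases hv i with h' | h' <;> simp_all [z]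
  -- If two coordinates separate `x` from all three points, a product of two affine functions works.
  have two (i j : α) (h : ∀ v, v = a ∨ v = b ∨ v = c → z v i = 1 ∨ z v j = 1) :
      ∃ f ∈ quadraticFunctions α, (∀ v, (∀ i, v i = 0 ∨ v i = 1) → 0 ≤ f v) ∧
        f a = 0 ∧ f b = 0 ∧ f c = 0 ∧ 0 < f x := by
    have zero {v : α → ℝ} (hv : v = a ∨ v = b ∨ v = c) : (1 - z v i) * (1 - z v j) = 0 := by
      rcases h v hv with h | h <;> simp [h]
    refine ⟨fun v => (1 - z v i) * (1 - z v j), ?_, fun v hv => ?_, zero (by simp),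
      zero (by simp), zero (by simp), by simp [z_self]⟩
    · convert affine_mul_affine_mem_quadraticFunctions i j (1 - x i) (-(1 - 2 * x i)) (1 - x j)
        (-(1 - 2 * x j)) using 2
      simp only [z]
      ring
    · rcases z_bin hv i with h | h <;> rcases z_bin hv j with h' | h' <;> simp [h, h']
  obtain ⟨i, hi⟩ := z_ne ha hxa
  obtain ⟨j, hj⟩ := z_ne hb hxb
  obtain ⟨k, hk⟩ := z_ne hc hxc
  rcases z_bin ha j with haj | haj
  swap
  · exact two j k (by rintro v (rfl | rfl | rfl) <;> simp [*])
  rcases z_bin ha k with hak | hak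
  swap
  · exact two j k (by rintro v (rfl | rfl | rfl) <;> simp [*])
  rcases z_bin hb i with hbi | hbi
  swap
  · exact two i k (by rintro v (rfl | rfl | rfl) <;> simp [*])
  rcases z_bin hb k with hbk | hbk
  swap
  · exact two i k (by rintro v (rfl | rfl | rfl) <;> simp [*])
  rcases z_bin hc i with hci | hci
  swap
  · exact two i j (by rintro v (rfl | rfl | rfl) <;> simp [*])
  rcases z_bin hc j with hcj | hcj
  swap
  · exact two i j (by rintro v (rfl | rfl | rfl) <;> simp [*])
  refine ⟨fun v => (z v i + z v j + z v k - 1) ^ 2, ?_, fun v _ => sq_nonneg _, by simp [*],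
    by simp [*], by simp [*], by simp [z_self]⟩
  have mem (p q : α) : (fun v => z v p * z v q) ∈ quadraticFunctions α :=
    affine_mul_affine_mem_quadraticFunctions p q _ _ _ _
  have mem' (p : α) : (fun v => z v p) ∈ quadraticFunctions α := by
    convert affine_mul_affine_mem_quadraticFunctions p p (x p) (1 - 2 * x p) 1 0 using 2
    simp [z]
  have h := add_mem (add_mem (add_mem (mem i i) (mem j j))
    (add_mem (mem k k) (const_mem_quadraticFunctions 1)))
    (Submodule.smul_mem _ 2 (sub_mem (add_mem (add_mem (mem i j) (mem i k)) (mem j k))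
      (add_mem (add_mem (mem' i) (mem' j)) (mem' k))))
  convert h using 1
  ext v
  simp only [Pi.add_apply, Pi.sub_apply, Pi.smul_apply, smul_eq_mul]
  ring

end

theorem Set.exists_eq_triple_of_ncard_le_three {β : Type*} {S : Set β} (hS : S.Finite)
    (hne : S.Nonempty) (h : S.ncard ≤ 3) : ∃ a b c, S = {a, b, c} := by
  have hpos := (Set.ncard_pos hS).2 hne
  obtain h | h | h : S.ncard = 1 ∨ S.ncard = 2 ∨ S.ncard = 3 := by omega
  · obtain ⟨a, rfl⟩ := Set.ncard_eq_one.1 h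
    exact ⟨a, a, a, by simp⟩
  · obtain ⟨a, b, -, rfl⟩ := Set.ncard_eq_two.1 h
    exact ⟨a, b, b, by simp⟩
  · obtain ⟨a, b, c, -, -, -, rfl⟩ := Set.ncard_eq_three.1 h
    exact ⟨a, b, c, rfl⟩

/-- `conv BQP(n)` is 3-neighborly: every nonempty set of at most three vertices
is the vertex set of a face. -/
theorem bqp_three_neighborly (n : ℕ) (hn : 2 ≤ n) :
    ∀ S ⊆ BQP (Fin n), S.Nonempty → S.ncard ≤ 3 →
      IsVertexSetOfFace (BQP (Fin n)) S := by
  intro S hS hne hcard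
  have hV := BQP_finite (Fin n)
  refine isVertexSetOfFace_of_forall_exists hV hS hne ?_
  obtain ⟨A, B, C, rfl⟩ := Set.exists_eq_triple_of_ncard_le_three (hV.subset hS) hne hcard
  obtain ⟨a, ha, rfl⟩ := hS (show A ∈ _ by simp)
  obtain ⟨b, hb, rfl⟩ := hS (show B ∈ _ by simp)
  obtain ⟨c, hc, rfl⟩ := hS (show C ∈ _ by simp)
  rintro _ ⟨⟨x, hx, rfl⟩, hxS⟩
  obtain ⟨f, ⟨φ, d, hf⟩, hnonneg, hfa, hfb, hfc, hfx⟩ :=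
    exists_mem_quadraticFunctions_separating hx ha hb hc
      (by rintro rfl; simp at hxS) (by rintro rfl; simp at hxS) (by rintro rfl; simp at hxS)
  rw [hf _ ha] at hfa
  rw [hf _ hb] at hfb
  rw [hf _ hc] at hfc
  rw [hf _ hx] at hfx
  refine ⟨-φ, d, ?_, ?_, ?_⟩
  · rintro _ ⟨v, hv, rfl⟩
    have := hnonneg v hv
    rw [hf v hv] at this
    rw [LinearMap.neg_apply]
    linarith
  · rintro s (rfl | rfl | rfl) <;> rw [LinearMap.neg_apply] <;> linarith
  · rw [LinearMap.neg_apply]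
    linarith
end

section
/- For every n ≥ 2, a vector y ∈ {0,1}^{n⁴} (with coordinates y_{ijkl}, i,j,k,l ∈ [n]) belongs to QAP(n) if and only if it satisfies: y_{ijkl} = y_{ijij}·y_{klkl} for all i,j,k,l ∈ [n]; ∑_{j∈[n]} y_{ijij} = 1 for all i ∈ [n]; and ∑_{i∈[n]} y_{ijij} = 1 for all j ∈ [n]. -/
theorem existsUnique_eq_one_of_sum_eq_one {ι : Type*} [Fintype ι] {f : ι → ℝ}
    (hf : ∀ i, f i = 0 ∨ f i = 1) (hsum : ∑ i, f i = 1) : ∃! i, f i = 1 := by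
  classical
  have hex : ∃ i, f i = 1 := by
    by_contra! h
    have hzero : ∀ i, f i = 0 := fun i => (hf i).resolve_right (h i)
    simp [hzero] at hsum
  obtain ⟨i, hi⟩ := hex
  refine ⟨i, hi, fun j hj => ?_⟩
  by_contra hne
  have hle : ∑ k ∈ {i, j}, f k ≤ ∑ k, f k :=
    Finset.sum_le_sum_of_subset_of_nonneg (Finset.subset_univ _) fun k _ _ => by
      rcases hf k with h | h <;> simp [h]
  rw [Finset.sum_pair (Ne.symm hne), hi, hj, hsum] at hle
  norm_num at hle

/-- A 0/1 matrix with all row and column sums equal to one is a permutation matrix. -/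
theorem exists_eq_permMat {n : ℕ} {x : Fin n → Fin n → ℝ}
    (hx : ∀ i j, x i j = 0 ∨ x i j = 1)
    (hrow : ∀ i, ∑ j, x i j = 1) (hcol : ∀ j, ∑ i, x i j = 1) :
    ∃ σ : Equiv.Perm (Fin n), x = permMat σ := by
  choose f hf hf_unique using fun i =>
    existsUnique_eq_one_of_sum_eq_one (hx i) (hrow i)
  have hinj : Function.Injective f := fun a b hab =>
    (existsUnique_eq_one_of_sum_eq_one (fun i => hx i (f a)) (hcol (f a))).unique
      (hf a) (hab ▸ hf b)
  refine ⟨Equiv.ofBijective f (Finite.injective_iff_bijective.mp hinj), ?_⟩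
  ext i j
  simp only [permMat, Equiv.ofBijective_apply]
  split_ifs with h
  · exact h ▸ hf i
  · exact (hx i j).resolve_right fun h1 => h (hf_unique i j h1).symm

/-- A 0/1 vector `y` lies in `QAP(n)` iff `y_{ijkl} = y_{ijij} y_{klkl}`,
`∑_j y_{ijij} = 1` and `∑_i y_{ijij} = 1`. -/
theorem qap_characterization (n : ℕ) (hn : 2 ≤ n)
    (y : Fin n → Fin n → Fin n → Fin n → ℝ)
    (hy : ∀ i j k l, y i j k l = 0 ∨ y i j k l = 1) :
    y ∈ QAP n ↔
      (∀ i j k l, y i j k l = y i j i j * y k l k l) ∧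
      (∀ i, ∑ j, y i j i j = 1) ∧
      (∀ j, ∑ i, y i j i j = 1) := by
  constructor
  · rintro ⟨σ, rfl⟩
    refine ⟨fun i j k l => ?_, fun i => by simp [permMat], fun j => ?_⟩
    · simp only [permMat]
      split_ifs <;> simp
    · simp [permMat, ← Equiv.eq_symm_apply]
  · rintro ⟨hmul, hrow, hcol⟩
    obtain ⟨σ, hσ⟩ := exists_eq_permMat (fun i j => hy i j i j) hrow hcol
    refine ⟨σ, ?_⟩
    ext i j k l
    rw [hmul, ← hσ]
end

section
/- For every n ≥ 3, the set conv{z^σ : σ a permutation of [n] fixing every vertex in {4,5,…,n}} is a face of conv(φ_n); it is the intersection of conv(φ_n) with the supporting hyperplanes z_{ijkl} = 0 for all admissible indices with j > 3 and l ≠ j. -/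
/-- If a linear functional is nonpositive on `V`, then the points of `conv V` at which it vanishes
lie in the convex hull of the points of `V` at which it vanishes. -/
theorem mem_convexHull_of_linearMap_eq_zero {E : Type*} [AddCommGroup E] [Module ℝ E] {V : Set E}
    (φ : E →ₗ[ℝ] ℝ) (hφ : ∀ v ∈ V, φ v ≤ 0) {z : E} (hz : z ∈ convexHull ℝ V) (h0 : φ z = 0) :
    z ∈ convexHull ℝ {v ∈ V | φ v = 0} := by
  have hconv : Convex ℝ {x : E | φ x ≤ 0 ∧ (φ x = 0 → x ∈ convexHull ℝ {v ∈ V | φ v = 0})} := by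
    rintro x ⟨hx, hx'⟩ y ⟨hy, hy'⟩ a b ha hb hab
    rcases ha.eq_or_lt with rfl | ha
    · obtain rfl : b = 1 := by linarith
      simpa using ⟨hy, hy'⟩
    rcases hb.eq_or_lt with rfl | hb
    · obtain rfl : a = 1 := by linarith
      simpa using ⟨hx, hx'⟩
    have hax : a * φ x ≤ 0 := mul_nonpos_of_nonneg_of_nonpos ha.le hx
    have hby : b * φ y ≤ 0 := mul_nonpos_of_nonneg_of_nonpos hb.le hy
    simp only [Set.mem_ofPred_eq, map_add, map_smul, smul_eq_mul]
    refine ⟨by linarith, fun h => ?_⟩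
    have hx0 : φ x = 0 :=
      (mul_eq_zero.1 (show a * φ x = 0 by linarith)).resolve_left ha.ne'
    have hy0 : φ y = 0 :=
      (mul_eq_zero.1 (show b * φ y = 0 by linarith)).resolve_left hb.ne'
    exact convex_convexHull ℝ _ (hx' hx0) (hy' hy0) ha.le hb.le hab
  have hsub : V ⊆ {x : E | φ x ≤ 0 ∧ (φ x = 0 → x ∈ convexHull ℝ {v ∈ V | φ v = 0})} :=
    fun v hv => ⟨hφ v hv, fun h => subset_convexHull ℝ _ ⟨hv, h⟩⟩
  exact (convexHull_min hsub hconv hz).2 h0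

/-- A permutation fixes every vertex `≥ 3` iff it maps every edge with largest vertex `j ≥ 3` to an
edge with largest vertex `j`. -/
theorem zMat_eq_zero_iff_fixes_tail {n : ℕ} (hn : 3 ≤ n) (σ : Equiv.Perm (Fin n)) :
    (∀ i j k l : Fin n, i < j → k < l → 3 ≤ j.val → l ≠ j → zMat σ {i, j} {k, l} = 0) ↔
      ∀ v : Fin n, 3 ≤ v.val → σ v = v := by
  constructor
  · intro h v hv
    have hmem : ∀ i : Fin n, i < v → σ i = v ∨ σ v = v := by
      intro i hi
      by_contra! hne
      have key : ∀ k l : Fin n, k < l → l ≠ v → ({σ i, σ v} : Finset (Fin n)) ≠ {k, l} := by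
        intro k l hkl hl heq
        have := h i v k l hi hkl hv hl
        simp [zMat, Finset.card_pair hi.ne, Finset.image_insert, heq] at this
      rcases lt_or_gt_of_ne (σ.injective.ne hi.ne) with hlt | hlt
      · exact key _ _ hlt hne.2 rfl
      · exact key _ _ hlt hne.1 (Finset.pair_comm _ _)
    by_contra hne
    have h0 := (hmem ⟨0, by omega⟩ (Fin.lt_def.2 (by simp; omega))).resolve_right hne
    have h1 := (hmem ⟨1, by omega⟩ (Fin.lt_def.2 (by simp; omega))).resolve_right hne
    simpa using σ.injective (h0.trans h1.symm)
  · intro h i j k l hij hkl hj hl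
    have hσi : σ i < j := by
      by_cases hi : 3 ≤ i.val
      · rwa [h i hi]
      · by_contra! hle
        have hfix := σ.injective (h (σ i) (hj.trans hle))
        rw [hfix] at hle
        exact absurd hij hle.not_gt
    have hne : ({σ i, j} : Finset (Fin n)) ≠ {k, l} := by
      intro heq
      have hjm : j ∈ ({k, l} : Finset (Fin n)) := heq ▸ by simp
      have hlm : l ∈ ({σ i, j} : Finset (Fin n)) := heq ▸ by simp
      simp only [Finset.mem_insert, Finset.mem_singleton] at hjm hlm
      rcases hlm with rfl | rfl
      · rcases hjm with rfl | rfl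
        · exact absurd hkl hσi.not_gt
        · exact hl rfl
      · exact hl rfl
    simp [zMat, Finset.image_insert, h j hj, hne]

/-- The convex hull of the `z^σ` for permutations `σ` of `[n]` fixing every vertex in
`{4,…,n}` (1-based; 0-based: every vertex `≥ 3`) is a face of `conv φ_n`, namely its
intersection with the supporting hyperplanes `z_{ijkl} = 0` for admissible indices
with `j > 3` and `l ≠ j`. -/
theorem fixing_tail_face (n : ℕ) (hn : 3 ≤ n) :
    let S : Set (EdgeSpace n) :=
      {z | ∃ σ : Equiv.Perm (Fin n), (∀ v : Fin n, 3 ≤ v.val → σ v = v) ∧ z = zMat σ}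
    IsFaceOf (convexHull ℝ S) (convexHull ℝ (phi n)) ∧
    convexHull ℝ S =
      {z ∈ convexHull ℝ (phi n) |
        ∀ i j k l : Fin n, i < j → k < l → 3 ≤ j.val → l ≠ j →
          z {i, j} {k, l} = 0} := by
  intro S
  let A : Finset (Fin n × Fin n × Fin n × Fin n) :=
    {p | p.1 < p.2.1 ∧ p.2.2.1 < p.2.2.2 ∧ 3 ≤ p.2.1.val ∧ p.2.2.2 ≠ p.2.1}
  let φ : EdgeSpace n →ₗ[ℝ] ℝ :=
    -∑ p ∈ A, LinearMap.proj {p.2.2.1, p.2.2.2} ∘ₗ LinearMap.proj {p.1, p.2.1}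
  have hφ : ∀ z, φ z = -∑ p ∈ A, z {p.1, p.2.1} {p.2.2.1, p.2.2.2} := by
    intro z
    simp [φ, LinearMap.sum_apply]
  have hφ0 : ∀ z : EdgeSpace n, (∀ i j k l : Fin n, i < j → k < l → 3 ≤ j.val → l ≠ j →
      z {i, j} {k, l} = 0) → φ z = 0 := by
    intro z hz
    rw [hφ, neg_eq_zero]
    refine Finset.sum_eq_zero fun p hp => ?_
    simp only [A, Finset.mem_filter, Finset.mem_univ, true_and] at hp
    exact hz _ _ _ _ hp.1 hp.2.1 hp.2.2.1 hp.2.2.2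
  have hφle : ∀ v ∈ phi n, φ v ≤ 0 := by
    rintro _ ⟨σ, rfl⟩
    rw [hφ, neg_nonpos]
    exact Finset.sum_nonneg fun p _ => zMat_nonneg σ _ _
  have hS : {v ∈ phi n | φ v = 0} ⊆ S := by
    rintro _ ⟨⟨σ, rfl⟩, h0⟩
    refine ⟨σ, (zMat_eq_zero_iff_fixes_tail hn σ).1 fun i j k l hij hkl hj hl => ?_, rfl⟩
    rw [hφ, neg_eq_zero, Finset.sum_eq_zero_iff_of_nonneg fun p _ => zMat_nonneg σ _ _] at h0
    exact h0 (i, j, k, l) (by simp [A, hij, hkl, hj, hl])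
  have hSphi : convexHull ℝ S ⊆ convexHull ℝ (phi n) :=
    convexHull_mono fun z ⟨σ, _, hz⟩ => ⟨σ, hz⟩
  have hzero : ∀ z ∈ convexHull ℝ S, ∀ i j k l : Fin n, i < j → k < l → 3 ≤ j.val → l ≠ j →
      z {i, j} {k, l} = 0 := by
    intro z hz i j k l hij hkl hj hl
    have hsub : S ⊆ {z : EdgeSpace n | z {i, j} {k, l} = 0} := by
      rintro _ ⟨σ, hσ, rfl⟩
      exact (zMat_eq_zero_iff_fixes_tail hn σ).2 hσ i j k l hij hkl hj hl
    refine convexHull_min hsub ?_ hz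
    intro x hx y hy a b _ _ _
    simp_all
  have hmem : ∀ z ∈ convexHull ℝ (phi n), φ z = 0 → z ∈ convexHull ℝ S := fun z hz h0 =>
    convexHull_mono hS (mem_convexHull_of_linearMap_eq_zero φ hφle hz h0)
  have hmax : ∀ y ∈ convexHull ℝ (phi n), φ y ≤ 0 := fun y hy =>
    convexHull_min (t := {x | φ x ≤ 0}) hφle (convex_halfSpace_le φ.isLinear 0) hy
  refine ⟨Or.inr ⟨φ, Set.Subset.antisymm ?_ ?_⟩, Set.Subset.antisymm ?_ ?_⟩
  · intro z hz
    refine ⟨hSphi hz, fun y hy => ?_⟩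
    rw [hφ0 z (hzero z hz)]
    exact hmax y hy
  · rintro z ⟨hz, hle⟩
    have hone : zMat 1 ∈ convexHull ℝ S := subset_convexHull ℝ S ⟨1, fun _ _ => rfl, rfl⟩
    have h1 := hle _ (hSphi hone)
    rw [hφ0 _ (hzero _ hone)] at h1
    exact hmem z hz (le_antisymm (hmax z hz) h1)
  · exact fun z hz => ⟨hSphi hz, hzero z hz⟩
  · exact fun z hz => hmem z hz.1 (hφ0 z hz.2)
end

section
/- For every n ≥ 4, the polytope conv(φ_n) has a 3-neighborly face with exactly 2^{⌊n/2⌋} vertices; namely, the face of conv(φ_n) whose vertices are the edge-permutation matrices z^σ of the 2^{⌊n/2⌋} permutations σ of [n] that map each pair {2i−1,2i}, i ∈ [⌊n/2⌋], to itself (and fix the last vertex if n is odd) is 3-neighborly. -/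
/-- The linear functional with coefficient matrix `c`. -/
def costFunctional {n : ℕ} (c : Finset (Fin n) → Finset (Fin n) → ℝ) : EdgeSpace n →ₗ[ℝ] ℝ where
  toFun z := ∑ e, ∑ f, c e f * z e f
  map_add' x y := by simp [mul_add, Finset.sum_add_distrib]
  map_smul' r x := by simp [Finset.mul_sum, mul_left_comm]

theorem costFunctional_zMat {n : ℕ} (c : Finset (Fin n) → Finset (Fin n) → ℝ)
    (σ : Equiv.Perm (Fin n)) :
    costFunctional c (zMat σ) = ∑ e with e.card = 2, c e (e.image σ) := by
  simp only [costFunctional, zMat, LinearMap.coe_mk, AddHom.coe_mk, Finset.sum_filter]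
  refine Finset.sum_congr rfl fun e _ => ?_
  by_cases h : e.card = 2 <;> simp [h]

theorem costFunctional_zMat_nonneg {n : ℕ} {c : Finset (Fin n) → Finset (Fin n) → ℝ}
    (hc : ∀ e f, 0 ≤ c e f) (σ : Equiv.Perm (Fin n)) : 0 ≤ costFunctional c (zMat σ) := by
  rw [costFunctional_zMat]
  exact Finset.sum_nonneg fun e _ => hc _ _

theorem costFunctional_zMat_eq_zero_iff {n : ℕ} {c : Finset (Fin n) → Finset (Fin n) → ℝ}
    (hc : ∀ e f, 0 ≤ c e f) (σ : Equiv.Perm (Fin n)) :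
    costFunctional c (zMat σ) = 0 ↔ ∀ e : Finset (Fin n), e.card = 2 → c e (e.image σ) = 0 := by
  rw [costFunctional_zMat, Finset.sum_eq_zero_iff_of_nonneg fun e _ => hc _ _]
  simp

section Faces

variable {E : Type*} [AddCommGroup E] [Module ℝ E]

theorem le_of_mem_convexHull {V : Set E} (φ : E →ₗ[ℝ] ℝ) {m : ℝ} (hm : ∀ v ∈ V, m ≤ φ v)
    {x : E} (hx : x ∈ convexHull ℝ V) : m ≤ φ x :=
  convexHull_min (t := {x | m ≤ φ x}) hm (convex_halfSpace_ge φ.isLinear m) hx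

theorem eq_of_mem_convexHull {T : Set E} (φ : E →ₗ[ℝ] ℝ) {m : ℝ} (hm : ∀ v ∈ T, φ v = m)
    {x : E} (hx : x ∈ convexHull ℝ T) : φ x = m :=
  convexHull_min (t := {x | φ x = m}) hm (convex_hyperplane φ.isLinear m) hx

theorem mem_convexHull_of_eq {V T : Set E} (φ : E →ₗ[ℝ] ℝ) {m : ℝ}
    (hT : ∀ v ∈ T, φ v = m) (hV : ∀ v ∈ V, v ∉ T → m < φ v)
    {x : E} (hx : x ∈ convexHull ℝ V) (hxm : φ x = m) : x ∈ convexHull ℝ T := by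
  have hconv : Convex ℝ {x : E | m < φ x ∨ x ∈ convexHull ℝ T} := by
    have hle : ∀ x ∈ {x : E | m < φ x ∨ x ∈ convexHull ℝ T}, m ≤ φ x := by
      rintro x (h | h)
      · exact h.le
      · exact (eq_of_mem_convexHull φ hT h).ge
    rw [convex_iff_forall_pos]
    intro x hx y hy a b ha hb hab
    by_cases h : x ∈ convexHull ℝ T ∧ y ∈ convexHull ℝ T
    · exact Or.inr (convex_convexHull ℝ T h.1 h.2 ha.le hb.le hab)
    · left
      have h1 := hle x hx
      have h2 := hle y hy
      have h3 : m < φ x ∨ m < φ y := by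
        rcases hx with hx | hx
        · exact Or.inl hx
        · rcases hy with hy | hy
          · exact Or.inr hy
          · exact absurd ⟨hx, hy⟩ h
      have hm : a * m + b * m = m := by rw [← add_mul, hab, one_mul]
      simp only [map_add, map_smul, smul_eq_mul]
      rcases h3 with h3 | h3
      · nlinarith [mul_lt_mul_of_pos_left h3 ha, mul_le_mul_of_nonneg_left h2 hb.le]
      · nlinarith [mul_lt_mul_of_pos_left h3 hb, mul_le_mul_of_nonneg_left h1 ha.le]
  have hmem : x ∈ {x : E | m < φ x ∨ x ∈ convexHull ℝ T} := by
    refine convexHull_min (fun v hv => ?_) hconv hx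
    by_cases hvT : v ∈ T
    · exact Or.inr (subset_convexHull ℝ T hvT)
    · exact Or.inl (hV v hv hvT)
  rcases hmem with h | h
  · exact absurd hxm h.ne'
  · exact h

/-- If a linear functional attains its minimum over `V` exactly on `T`, then `conv T` is a face
of `conv V`. -/
theorem isFaceOf_convexHull {V T : Set E} (hTV : T ⊆ V) (hne : T.Nonempty) (φ : E →ₗ[ℝ] ℝ)
    {m : ℝ} (hT : ∀ v ∈ T, φ v = m) (hV : ∀ v ∈ V, v ∉ T → m < φ v) :
    IsFaceOf (convexHull ℝ T) (convexHull ℝ V) := by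
  have hle : ∀ v ∈ V, m ≤ φ v := fun v hv => by
    by_cases h : v ∈ T
    · exact (hT v h).ge
    · exact (hV v hv h).le
  refine Or.inr ⟨-φ, Set.ext fun x => ⟨fun hx => ⟨convexHull_mono hTV hx, fun y hy => ?_⟩, ?_⟩⟩
  · simpa [eq_of_mem_convexHull φ hT hx] using le_of_mem_convexHull φ hle hy
  · rintro ⟨hx, hmax⟩
    obtain ⟨t, ht⟩ := hne
    have h := hmax t (subset_convexHull ℝ V (hTV ht))
    refine mem_convexHull_of_eq φ hT hV hx (le_antisymm ?_ (le_of_mem_convexHull φ hle hx))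
    simpa [hT t ht] using h

theorem isVertexSetOfFace_of_minimizers {V T : Set E} (hTV : T ⊆ V) (hne : T.Nonempty)
    (φ : E →ₗ[ℝ] ℝ) {m : ℝ} (hT : ∀ v ∈ T, φ v = m) (hV : ∀ v ∈ V, v ∉ T → m < φ v) :
    IsVertexSetOfFace V T := by
  refine ⟨_, isFaceOf_convexHull hTV hne φ hT hV, Set.ext fun x => ⟨?_, fun hx =>
    ⟨subset_convexHull ℝ T hx, hTV hx⟩⟩⟩
  rintro ⟨hx, hxV⟩
  by_contra hxT
  exact (hV x hxV hxT).ne' (eq_of_mem_convexHull φ hT hx)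

end Faces

/-- `σ` maps each pair `{2i, 2i+1}` to itself. -/
def PreservesPairs {n : ℕ} (σ : Equiv.Perm (Fin n)) : Prop :=
  ∀ v : Fin n, (σ v).val / 2 = v.val / 2

namespace PreservesPairs

variable {n : ℕ} {σ τ : Equiv.Perm (Fin n)}

theorem apply_eq_of_same_pair (hσ : PreservesPairs σ) (hτ : PreservesPairs τ) {u v : Fin n}
    (huv : u.val / 2 = v.val / 2) (h : σ u = τ u) : σ v = τ v := by
  by_cases huv' : u = v
  · rwa [← huv']
  have h1 : (σ u).val ≠ (σ v).val := fun h => huv' (σ.injective (Fin.ext h))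
  have h2 : (τ u).val ≠ (τ v).val := fun h => huv' (τ.injective (Fin.ext h))
  have h3 := congrArg Fin.val h
  have := hσ u
  have := hσ v
  have := hτ v
  ext
  omega

theorem image_pair_eq_iff (hσ : PreservesPairs σ) (hτ : PreservesPairs τ) {u v : Fin n}
    (huv : u.val / 2 ≠ v.val / 2) :
    ({u, v} : Finset (Fin n)).image σ = ({u, v} : Finset (Fin n)).image τ ↔
      σ u = τ u ∧ σ v = τ v := by
  have key : ∀ {a b : Fin n}, a.val / 2 ≠ b.val / 2 → σ a ≠ τ b := by
    intro a b hab h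
    exact hab (by rw [← hσ a, ← hτ b, h])
  constructor
  · intro h
    have h1 : σ u ∈ ({u, v} : Finset (Fin n)).image τ := by rw [← h]; simp
    have h2 : σ v ∈ ({u, v} : Finset (Fin n)).image τ := by rw [← h]; simp
    simp only [Finset.image_insert, Finset.image_singleton, Finset.mem_insert,
      Finset.mem_singleton] at h1 h2
    exact ⟨h1.resolve_right (key huv), h2.resolve_left (key huv.symm)⟩
  · rintro ⟨h1, h2⟩
    simp [h1, h2]

end PreservesPairs

theorem exists_other_pair {n : ℕ} (hn : 4 ≤ n) (v : Fin n) :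
    ∃ w : Fin n, v.val / 2 ≠ w.val / 2 := by
  by_cases h : v.val / 2 = 0
  · exact ⟨⟨2, by omega⟩, by simp [h]⟩
  · exact ⟨⟨0, by omega⟩, by simpa using h⟩

theorem card_pair_of_other_pair {n : ℕ} {u v : Fin n} (h : u.val / 2 ≠ v.val / 2) :
    ({u, v} : Finset (Fin n)).card = 2 :=
  Finset.card_pair fun huv => h (by rw [huv])

theorem zMat_injOn {n : ℕ} (hn : 4 ≤ n) :
    Set.InjOn zMat {σ : Equiv.Perm (Fin n) | PreservesPairs σ} := by
  intro σ hσ τ hτ h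
  ext v : 1
  obtain ⟨w, hw⟩ := exists_other_pair hn v
  have h1 := congrFun (congrFun h {v, w}) (({v, w} : Finset (Fin n)).image σ)
  simp only [zMat, card_pair_of_other_pair hw, true_and, if_true] at h1
  have h2 : ({v, w} : Finset (Fin n)).image τ = ({v, w} : Finset (Fin n)).image σ := by
    by_contra hne
    rw [if_neg hne] at h1
    exact one_ne_zero h1
  exact ((PreservesPairs.image_pair_eq_iff hτ hσ hw).1 h2).1.symm

theorem card_preservesPairs (n : ℕ) :
    Nat.card {σ : Equiv.Perm (Fin n) // PreservesPairs σ} = 2 ^ (n / 2) := by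
  classical
  let f : Fin n → Fin (n / 2 + 1) := fun v => ⟨v.val / 2, by omega⟩
  have hequiv : ∀ σ : Equiv.Perm (Fin n), PreservesPairs σ ↔ f ∘ σ = f := by
    intro σ
    simp [PreservesPairs, funext_iff, f]
  rw [Nat.card_congr (Equiv.subtypeEquivRight hequiv), Nat.card_eq_fintype_card,
    DomMulAct.stabilizer_card, Fin.prod_univ_castSucc]
  have hlt : ∀ i : Fin (n / 2), Fintype.card {a // f a = i.castSucc} = 2 := by
    intro i
    have hi := i.isLt
    rw [Fintype.card_subtype, Finset.card_eq_two]
    refine ⟨⟨2 * i, by omega⟩, ⟨2 * i + 1, by omega⟩, by simp, ?_⟩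
    ext a
    simp [f, Fin.ext_iff]
    omega
  have hlast : Fintype.card {a // f a = Fin.last (n / 2)} ≤ 1 := by
    rw [Fintype.card_le_one_iff_subsingleton]
    refine ⟨fun a b => Subtype.ext (Fin.ext ?_)⟩
    have ha := congrArg Fin.val a.2
    have hb := congrArg Fin.val b.2
    simp only [f, Fin.val_last] at ha hb
    omega
  simp [hlt, Nat.factorial_eq_one.2 hlast]

/-- The edge `e` is one of the pairs `{2i, 2i+1}`. -/
def IsPair {n : ℕ} (e : Finset (Fin n)) : Prop :=
  ∀ u ∈ e, ∀ v ∈ e, u.val / 2 = v.val / 2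

theorem preservesPairs_iff_image_pair {n : ℕ} (σ : Equiv.Perm (Fin n)) :
    PreservesPairs σ ↔
      ∀ e : Finset (Fin n), e.card = 2 → IsPair e → e.image σ = e := by
  constructor
  · intro hσ e he hpair
    refine Finset.eq_of_subset_of_card_le ?_ (by rw [Finset.card_image_of_injective _ σ.injective])
    obtain ⟨a, b, hab, rfl⟩ := Finset.card_eq_two.1 he
    have h1 := hpair a (by simp) b (by simp)
    have hab' : a.val ≠ b.val := fun h => hab (Fin.ext h)
    intro x hx
    simp only [Finset.image_insert, Finset.image_singleton, Finset.mem_insert,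
      Finset.mem_singleton] at hx ⊢
    have h2 := hσ a
    have h3 := hσ b
    rcases hx with rfl | rfl <;> simp only [Fin.ext_iff] <;> omega
  · intro h
    have key : ∀ a b : Fin n, a ≠ b → a.val / 2 = b.val / 2 →
        ({a, b} : Finset (Fin n)).image σ = {a, b} := by
      intro a b hab hdiv
      refine h _ (Finset.card_pair hab) ?_
      intro u hu v hv
      simp only [Finset.mem_insert, Finset.mem_singleton] at hu hv
      rcases hu with rfl | rfl <;> rcases hv with rfl | rfl <;> simp [hdiv]
    intro v
    by_cases hv : ∃ w, v ≠ w ∧ v.val / 2 = w.val / 2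
    · obtain ⟨w, hvw, hdiv⟩ := hv
      have hmem : σ v ∈ ({v, w} : Finset (Fin n)) := by
        rw [← key v w hvw hdiv]; simp
      simp only [Finset.mem_insert, Finset.mem_singleton] at hmem
      rcases hmem with h | h <;> rw [h]
      exact hdiv.symm
    · by_cases hw : ∃ w, σ v ≠ w ∧ (σ v).val / 2 = w.val / 2
      · obtain ⟨w, hvw, hdiv⟩ := hw
        have hmem : σ v ∈ ({σ v, w} : Finset (Fin n)).image σ := by
          rw [key _ w hvw hdiv]; simp
        rw [Finset.mem_image] at hmem
        obtain ⟨x, hx, hxv⟩ := hmem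
        rw [σ.injective hxv] at hx
        simp only [Finset.mem_insert, Finset.mem_singleton] at hx
        rcases hx with h | h
        · rw [← h]
        · rw [hdiv, ← h]
      · push Not at hv hw
        have last : ∀ a : Fin n, (∀ w, a ≠ w → a.val / 2 ≠ w.val / 2) → a.val + 1 = n := by
          intro a ha
          by_contra hne
          have hlt := a.isLt
          rcases Nat.mod_two_eq_zero_or_one a.val with h0 | h1
          · exact ha ⟨a.val + 1, by omega⟩ (by simp [Fin.ext_iff]) (by simp; omega)
          · exact ha ⟨a.val - 1, by omega⟩ (by simp [Fin.ext_iff]; omega) (by simp; omega)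
        have h1 := last _ hv
        have h2 := last _ hw
        omega

/-- The edge-permutation matrices of the permutations mapping each pair to itself. -/
def pairSet (n : ℕ) : Set (EdgeSpace n) :=
  {z | ∃ σ : Equiv.Perm (Fin n), PreservesPairs σ ∧ z = zMat σ}

theorem pairSet_eq_image (n : ℕ) :
    pairSet n = zMat '' {σ : Equiv.Perm (Fin n) | PreservesPairs σ} := by
  ext z
  simp [pairSet, eq_comm]

theorem ncard_pairSet {n : ℕ} (hn : 4 ≤ n) : (pairSet n).ncard = 2 ^ (n / 2) := by
  rw [pairSet_eq_image, (zMat_injOn hn).ncard_image, ← card_preservesPairs n]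
  rfl

theorem isFaceOf_convexHull_pairSet (n : ℕ) :
    IsFaceOf (convexHull ℝ (pairSet n)) (convexHull ℝ (phi n)) := by
  classical
  let c : Finset (Fin n) → Finset (Fin n) → ℝ := fun e f => if IsPair e ∧ f ≠ e then 1 else 0
  have hc : ∀ e f, 0 ≤ c e f := fun e f => by simp only [c]; split_ifs <;> norm_num
  have hiff : ∀ σ : Equiv.Perm (Fin n),
      costFunctional c (zMat σ) = 0 ↔ PreservesPairs σ := by
    intro σ
    rw [costFunctional_zMat_eq_zero_iff hc, preservesPairs_iff_image_pair]
    simp [c]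
  refine isFaceOf_convexHull (m := 0) ?_ ⟨zMat 1, 1, fun v => rfl, rfl⟩ (costFunctional c) ?_ ?_
  · rintro _ ⟨σ, -, rfl⟩
    exact ⟨σ, rfl⟩
  · rintro _ ⟨σ, hσ, rfl⟩
    exact (hiff σ).2 hσ
  · rintro _ ⟨σ, rfl⟩ hσ
    refine lt_of_le_of_ne (costFunctional_zMat_nonneg hc σ) fun h => hσ ⟨σ, (hiff σ).1 h.symm, rfl⟩

/-- On every edge, `τ` agrees with one of the permutations in `A`. -/
def EdgewiseIn {n : ℕ} (A : Set (Equiv.Perm (Fin n))) (τ : Equiv.Perm (Fin n)) : Prop :=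
  ∀ e : Finset (Fin n), e.card = 2 → ∃ σ ∈ A, e.image τ = e.image σ

theorem EdgewiseIn.exists_apply_eq {n : ℕ} {A : Set (Equiv.Perm (Fin n))}
    (hA : ∀ σ ∈ A, PreservesPairs σ) {τ : Equiv.Perm (Fin n)} (hτ : PreservesPairs τ)
    (h : EdgewiseIn A τ) {u v : Fin n} (huv : u.val / 2 ≠ v.val / 2) :
    ∃ σ ∈ A, τ u = σ u ∧ τ v = σ v := by
  obtain ⟨σ, hσ, hσe⟩ := h _ (card_pair_of_other_pair huv)
  exact ⟨σ, hσ, (hτ.image_pair_eq_iff (hA σ hσ) huv).1 hσe⟩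

/-- A permutation outside `A = {a, b, c}` that agrees edgewise with `A` differs from at most one
of `a`, `b`, `c` at each vertex. -/
theorem EdgewiseIn.apply_eq_or {n : ℕ} (hn : 4 ≤ n) {a b c τ : Equiv.Perm (Fin n)}
    (hA : ∀ σ ∈ ({a, b, c} : Set (Equiv.Perm (Fin n))), PreservesPairs σ)
    (hτ : PreservesPairs τ) (h : EdgewiseIn {a, b, c} τ) (hc : τ ≠ c) (v : Fin n) :
    τ v = a v ∨ τ v = b v := by
  by_contra! hne
  obtain ⟨u, hu⟩ : ∃ u, τ u ≠ c u := by
    by_contra! h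
    exact hc (Equiv.ext h)
  by_cases huv : u.val / 2 = v.val / 2
  · obtain ⟨w, hw⟩ := exists_other_pair hn v
    obtain ⟨σ, hσ, h1, -⟩ := h.exists_apply_eq hA hτ hw
    rcases hσ with rfl | rfl | rfl
    · exact hne.1 h1
    · exact hne.2 h1
    · exact hu (hτ.apply_eq_of_same_pair (hA _ (by simp)) huv.symm h1)
  · obtain ⟨σ, hσ, h1, h2⟩ := h.exists_apply_eq hA hτ huv
    rcases hσ with rfl | rfl | rfl
    · exact hne.1 h2
    · exact hne.2 h2
    · exact hu h1

/-- The linear functional reading off one matrix entry. -/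
def entryFunctional {n : ℕ} (e f : Finset (Fin n)) : EdgeSpace n →ₗ[ℝ] ℝ :=
  LinearMap.proj f ∘ₗ LinearMap.proj e

open Classical in
theorem entryFunctional_zMat {n : ℕ} {σ τ : Equiv.Perm (Fin n)} (hσ : PreservesPairs σ)
    (hτ : PreservesPairs τ) {u v : Fin n} (huv : u.val / 2 ≠ v.val / 2) :
    entryFunctional {u, v} (({u, v} : Finset (Fin n)).image τ) (zMat σ) =
      if σ u = τ u ∧ σ v = τ v then 1 else 0 := by
  simp [entryFunctional, zMat, card_pair_of_other_pair huv, ← hσ.image_pair_eq_iff hτ huv,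
    -Finset.image_insert, -Finset.image_singleton]

open Classical in
/-- The coefficient matrix counting the edges at which a permutation differs from all members
of `A`. -/
noncomputable def edgewiseCost {n : ℕ} (A : Set (Equiv.Perm (Fin n)))
    (e f : Finset (Fin n)) : ℝ :=
  if ∃ σ ∈ A, f = e.image σ then 0 else 1

theorem edgewiseCost_nonneg {n : ℕ} (A : Set (Equiv.Perm (Fin n))) (e f : Finset (Fin n)) :
    0 ≤ edgewiseCost A e f := by
  unfold edgewiseCost
  split_ifs <;> norm_num

theorem edgewiseCost_eq_zero_iff {n : ℕ} {A : Set (Equiv.Perm (Fin n))}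
    {τ : Equiv.Perm (Fin n)} :
    costFunctional (edgewiseCost A) (zMat τ) = 0 ↔ EdgewiseIn A τ := by
  rw [costFunctional_zMat_eq_zero_iff (edgewiseCost_nonneg A)]
  simp [edgewiseCost, EdgewiseIn]

theorem EdgewiseIn.of_mem {n : ℕ} {A : Set (Equiv.Perm (Fin n))} {σ : Equiv.Perm (Fin n)}
    (h : σ ∈ A) : EdgewiseIn A σ := fun _ _ => ⟨σ, h, rfl⟩

theorem one_le_costFunctional_edgewiseCost {n : ℕ} {A : Set (Equiv.Perm (Fin n))}
    {τ : Equiv.Perm (Fin n)} (h : ¬EdgewiseIn A τ) :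
    1 ≤ costFunctional (edgewiseCost A) (zMat τ) := by
  unfold EdgewiseIn at h
  push Not at h
  obtain ⟨e, he, hne⟩ := h
  rw [costFunctional_zMat]
  calc (1 : ℝ) = edgewiseCost A e (e.image τ) := by
        rw [edgewiseCost, if_neg]
        rintro ⟨σ, hσ, h⟩
        exact hne σ hσ h
    _ ≤ _ := Finset.single_le_sum (f := fun e => edgewiseCost A e (e.image τ))
        (fun e _ => edgewiseCost_nonneg A _ _) (by simp [he])

theorem exists_functional_minimized_on {n : ℕ} (hn : 4 ≤ n) {a b c : Equiv.Perm (Fin n)}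
    (hA : ∀ σ ∈ ({a, b, c} : Set (Equiv.Perm (Fin n))), PreservesPairs σ) :
    ∃ (φ : EdgeSpace n →ₗ[ℝ] ℝ) (m : ℝ),
      (∀ σ ∈ ({a, b, c} : Set (Equiv.Perm (Fin n))), φ (zMat σ) = m) ∧
      ∀ σ, PreservesPairs σ → σ ∉ ({a, b, c} : Set (Equiv.Perm (Fin n))) → m < φ (zMat σ) := by
  classical
  set A : Set (Equiv.Perm (Fin n)) := {a, b, c} with hAdef
  by_cases hclosed : ∀ τ, PreservesPairs τ → EdgewiseIn A τ → τ ∈ A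
  · refine ⟨costFunctional (edgewiseCost A), 0,
      fun σ hσ => edgewiseCost_eq_zero_iff.2 (.of_mem hσ), fun σ hσ hσA => ?_⟩
    exact zero_lt_one.trans_le
      (one_le_costFunctional_edgewiseCost fun h => hσA (hclosed σ hσ h))
  push Not at hclosed
  obtain ⟨τ, hτ, hτA, hτn⟩ := hclosed
  have two : ∀ σ, PreservesPairs σ → EdgewiseIn A σ → σ ∉ A → ∀ v,
      (σ v = a v ∨ σ v = b v) ∧ (σ v = a v ∨ σ v = c v) ∧ (σ v = b v ∨ σ v = c v) := by
    intro σ hσ hσA hσn v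
    simp only [hAdef, Set.mem_insert_iff, Set.mem_singleton_iff, not_or] at hσn
    refine ⟨EdgewiseIn.apply_eq_or hn hA hσ hσA hσn.2.2 v, ?_, ?_⟩
    · have h : A = {a, c, b} := by rw [hAdef, Set.pair_comm b c]
      exact EdgewiseIn.apply_eq_or hn (h ▸ hA) hσ (h ▸ hσA) hσn.2.1 v
    · have h : A = {b, c, a} := by rw [hAdef, Set.insert_comm, Set.pair_comm a c]
      exact EdgewiseIn.apply_eq_or hn (h ▸ hA) hσ (h ▸ hσA) hσn.1 v
  have ex : ∀ σ ∈ A, ∃ u, τ u ≠ σ u := by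
    intro σ hσ
    by_contra! h
    exact hτn (Equiv.ext h ▸ hσ)
  have ha : a ∈ A := by simp [hAdef]
  have hb : b ∈ A := by simp [hAdef]
  have hc : c ∈ A := by simp [hAdef]
  obtain ⟨u, hu⟩ := ex a ha
  obtain ⟨v, hv⟩ := ex b hb
  obtain ⟨w, hw⟩ := ex c hc
  obtain ⟨hu1, hu2, -⟩ := two τ hτ hτA hτn u
  obtain ⟨hv1, -, hv2⟩ := two τ hτ hτA hτn v
  obtain ⟨-, hw1, hw2⟩ := two τ hτ hτA hτn w
  replace hu1 := hu1.resolve_left hu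
  replace hu2 := hu2.resolve_left hu
  replace hv1 := hv1.resolve_right hv
  replace hv2 := hv2.resolve_left hv
  replace hw1 := hw1.resolve_right hw
  replace hw2 := hw2.resolve_right hw
  have huv : u.val / 2 ≠ v.val / 2 := fun h =>
    hv (hτ.apply_eq_of_same_pair (hA b hb) h hu1)
  have huw : u.val / 2 ≠ w.val / 2 := fun h =>
    hw (hτ.apply_eq_of_same_pair (hA c hc) h hu2)
  have hvw : v.val / 2 ≠ w.val / 2 := fun h =>
    hw (hτ.apply_eq_of_same_pair (hA c hc) h hv2)
  refine ⟨2 • costFunctional (edgewiseCost A) +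
    (entryFunctional {u, v} (({u, v} : Finset (Fin n)).image τ) +
      entryFunctional {u, w} (({u, w} : Finset (Fin n)).image τ) +
      entryFunctional {v, w} (({v, w} : Finset (Fin n)).image τ)), 1, fun σ hσ => ?_,
    fun σ hσ hσA => ?_⟩
  · simp only [LinearMap.add_apply, LinearMap.smul_apply,
      edgewiseCost_eq_zero_iff.2 (EdgewiseIn.of_mem hσ), entryFunctional_zMat (hA σ hσ) hτ huv,
      entryFunctional_zMat (hA σ hσ) hτ huw, entryFunctional_zMat (hA σ hσ) hτ hvw]
    rcases hσ with rfl | rfl | rfl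
    · simp [hu.symm, hv1, hw1]
    · simp [hv.symm, hu1, hw2]
    · simp [hw.symm, hu2, hv2]
  · simp only [LinearMap.add_apply, LinearMap.smul_apply, entryFunctional_zMat hσ hτ huv,
      entryFunctional_zMat hσ hτ huw, entryFunctional_zMat hσ hτ hvw]
    by_cases hE : EdgewiseIn A σ
    · have hστ : σ = τ := by
        ext x : 1
        have h1 := two σ hσ hE hσA x
        have h2 := two τ hτ hτA hτn x
        grind
      subst hστ
      simp only [edgewiseCost_eq_zero_iff.2 hE]
      norm_num
    · have h1 := one_le_costFunctional_edgewiseCost hE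
      have hif : ∀ (p : Prop) [Decidable p], (0 : ℝ) ≤ if p then 1 else 0 := by
        intro p _
        split_ifs <;> norm_num
      have h2 := hif (σ u = τ u ∧ σ v = τ v)
      have h3 := hif (σ u = τ u ∧ σ w = τ w)
      have h4 := hif (σ v = τ v ∧ σ w = τ w)
      rw [two_nsmul]
      linarith

theorem exists_eq_insert_of_ncard_le_three {α : Type*} {T : Set α} (hfin : T.Finite)
    (hne : T.Nonempty) (hT : T.ncard ≤ 3) : ∃ a b c, T = {a, b, c} := by
  have hpos := (Set.ncard_pos hfin).2 hne
  have hcases : T.ncard = 1 ∨ T.ncard = 2 ∨ T.ncard = 3 := by omega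
  rcases hcases with h | h | h
  · obtain ⟨a, rfl⟩ := Set.ncard_eq_one.1 h
    exact ⟨a, a, a, by simp⟩
  · obtain ⟨a, b, -, rfl⟩ := Set.ncard_eq_two.1 h
    exact ⟨a, b, b, by simp⟩
  · obtain ⟨a, b, c, -, -, -, rfl⟩ := Set.ncard_eq_three.1 h
    exact ⟨a, b, c, rfl⟩

theorem isVertexSetOfFace_pairSet {n : ℕ} (hn : 4 ≤ n) {T : Set (EdgeSpace n)}
    (hTS : T ⊆ pairSet n) (hne : T.Nonempty) (hT : T.ncard ≤ 3) :
    IsVertexSetOfFace (pairSet n) T := by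
  have hfin : (pairSet n).Finite := by
    rw [pairSet_eq_image]
    exact (Set.toFinite _).image _
  obtain ⟨x, y, z, rfl⟩ := exists_eq_insert_of_ncard_le_three (hfin.subset hTS) hne hT
  obtain ⟨a, ha, rfl⟩ := hTS (show x ∈ _ by simp)
  obtain ⟨b, hb, rfl⟩ := hTS (show y ∈ _ by simp)
  obtain ⟨c, hc, rfl⟩ := hTS (show z ∈ _ by simp)
  obtain ⟨φ, m, hmin, hlt⟩ := exists_functional_minimized_on hn (a := a) (b := b) (c := c)
    (by rintro σ (rfl | rfl | rfl) <;> assumption)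
  refine isVertexSetOfFace_of_minimizers hTS hne φ (m := m) ?_ ?_
  · rintro _ (rfl | rfl | rfl) <;> exact hmin _ (by simp)
  · rintro _ ⟨σ, hσ, rfl⟩ hσT
    refine hlt σ hσ fun h => hσT ?_
    rcases h with rfl | rfl | rfl <;> simp

/-- For `n ≥ 4`, `conv φ_n` has a 3-neighborly face with exactly `2^⌊n/2⌋` vertices:
the face spanned by the `z^σ` of the permutations `σ` mapping each pair
`{2i-1,2i}`, `i ∈ [⌊n/2⌋]`, to itself (and fixing the last vertex if `n` is odd);
equivalently, the permutations with `⌊σ(v)/2⌋ = ⌊v/2⌋` for all `v` (0-based). -/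
theorem phi_has_three_neighborly_face (n : ℕ) (hn : 4 ≤ n) :
    let S : Set (EdgeSpace n) :=
      {z | ∃ σ : Equiv.Perm (Fin n),
        (∀ v : Fin n, (σ v).val / 2 = v.val / 2) ∧ z = zMat σ}
    IsFaceOf (convexHull ℝ S) (convexHull ℝ (phi n)) ∧
    S.ncard = 2 ^ (n / 2) ∧
    ∀ T ⊆ S, T.Nonempty → T.ncard ≤ 3 → IsVertexSetOfFace S T := by
  exact ⟨isFaceOf_convexHull_pairSet n, ncard_pairSet hn,
    fun _ hTS hne hT => isVertexSetOfFace_pairSet hn hTS hne hT⟩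
end
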